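/- arXiv:2112.10747 — 6 statements merged into one kernel-verified Lean document; each statement's English description precedes it below -/
import Mathlib

section
/- Let D = {(x₁,x₂) ∈ ℝ² : 0 < x₁ < 1 and 0 < x₂ < x₁^{2k}}. If T > 0 and ξ : [−T, 0] → ℝ² is a C¹ curve with ξ'(t) = ∇u(ξ(t)) for all t and ξ(0) ∈ D, then for every t ∈ [−T, 0), if both coordinates of ξ(t) are strictly positive, then ξ(t) ∈ D. -/
noncomputable section

/-- The potential `u(x₁,x₂) = C (x₁^{4k}/C + x₂²)^{1 - 1/(4k)} + 2 x₁`. -/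
def uu (k : ℕ) (C : ℝ) (x : ℝ × ℝ) : ℝ :=
  C * (x.1 ^ (4 * k) / C + x.2 ^ 2) ^ ((1:ℝ) - 1 / (4 * (k:ℝ))) + 2 * x.1

/-- The gradient of `u`, given by its two partial derivatives. -/
def gradU (k : ℕ) (C : ℝ) (x : ℝ × ℝ) : ℝ × ℝ :=
  (deriv (fun s => uu k C (s, x.2)) x.1, deriv (fun s => uu k C (x.1, s)) x.2)

/-- The region `D = {x : 0 < x₁ < 1, 0 < x₂ < x₁ ^ (2 k)}`. -/
def Dset (k : ℕ) : Set (ℝ × ℝ) :=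
  {x : ℝ × ℝ | 0 < x.1 ∧ x.1 < 1 ∧ 0 < x.2 ∧ x.2 < x.1 ^ (2 * k)}

/-- Away from the zero set of the first coordinate, `gradU` is given by the classical formula. -/
lemma gradU_eq (k : ℕ) (hk : 1 ≤ k) (C : ℝ) (hC : 0 < C) (x : ℝ × ℝ) (hx : 0 < x.1) :
    gradU k C x =
      ((4 * (k:ℝ) - 1) * x.1 ^ (4 * k - 1) *
          (x.1 ^ (4 * k) / C + x.2 ^ 2) ^ (-(1 / (4 * (k:ℝ)))) + 2,
        C * (4 * (k:ℝ) - 1) / (2 * (k:ℝ)) * x.2 *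
          (x.1 ^ (4 * k) / C + x.2 ^ 2) ^ (-(1 / (4 * (k:ℝ))))) := by
  have hk0 : (k:ℝ) ≠ 0 := by positivity
  have hA : x.1 ^ (4 * k) / C + x.2 ^ 2 ≠ 0 := by positivity
  have hexp : (1:ℝ) - 1 / (4 * (k:ℝ)) - 1 = -(1 / (4 * (k:ℝ))) := by ring
  have h₁ := (((((hasDerivAt_id x.1).pow (4 * k)).div_const C).add_const
    (x.2 ^ 2)).rpow_const (p := (1:ℝ) - 1 / (4 * (k:ℝ))) (Or.inl hA)).const_mul C
  have h₂ := h₁.add ((hasDerivAt_id x.1).const_mul 2)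
  have h₃ := ((((hasDerivAt_id x.2).pow 2).const_add (x.1 ^ (4 * k) / C)).rpow_const
    (p := (1:ℝ) - 1 / (4 * (k:ℝ))) (Or.inl hA)).const_mul C
  have h₄ := h₃.add_const (2 * x.1)
  refine Prod.ext (h₂.deriv.trans ?_) (h₄.deriv.trans ?_)
  · simp only [id, Pi.pow_apply, hexp]
    push_cast
    field_simp
  · simp only [id, Pi.pow_apply, hexp]
    push_cast
    field_simp
    ring

lemma gradU_fst_pos (k : ℕ) (hk : 1 ≤ k) (C : ℝ) (hC : 0 < C) (x : ℝ × ℝ) (hx : 0 < x.1) :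
    0 < (gradU k C x).1 := by
  rw [gradU_eq k hk C hC x hx]
  have hk1 : (1:ℝ) ≤ k := by exact_mod_cast hk
  have : 0 < 4 * (k:ℝ) - 1 := by linarith
  positivity

lemma half_le_one_add_inv_rpow (k : ℕ) (hk : 1 ≤ k) (C : ℝ) (hC : 1 ≤ C) :
    1 / 2 ≤ (1 + 1 / C) ^ (-(1 / (4 * (k:ℝ)))) := by
  have hk1 : (1:ℝ) ≤ k := by exact_mod_cast hk
  have hC1 : 1 / C ≤ 1 := by rw [div_le_one (by linarith)]; exact hC
  have hC0 : 0 < 1 / C := by positivity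
  calc (1:ℝ) / 2 ≤ (1 + 1 / C) ^ (-1 : ℝ) := by
        rw [Real.rpow_neg_one, one_div]
        exact inv_anti₀ (by positivity) (by linarith)
    _ ≤ _ := by
        apply Real.rpow_le_rpow_of_exponent_le (by linarith)
        have : 1 / (4 * (k:ℝ)) ≤ 1 := by
          rw [div_le_one (by positivity)]; linarith
        linarith

/-- On the curve `x₂ = x₁ ^ (2 k)` the gradient of `u` points strictly out of `D`. -/
lemma gradU_outward (k : ℕ) (hk : 1 ≤ k) (C : ℝ)
    (hC : 2 * (k:ℝ) * (4 * (k:ℝ) + 1) < C) (x : ℝ × ℝ) (hx : 0 < x.1) (hx1 : x.1 ≤ 1)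
    (hy : x.2 = x.1 ^ (2 * k)) :
    0 < (gradU k C x).2 - 2 * (k:ℝ) * x.1 ^ (2 * k - 1) * (gradU k C x).1 := by
  have hk1 : (1:ℝ) ≤ k := by exact_mod_cast hk
  have hC1 : 1 ≤ C := by nlinarith
  have hC0 : 0 < C := by linarith
  have ha := half_le_one_add_inv_rpow k hk C hC1
  rw [gradU_eq k hk C hC0 x hx, hy]
  obtain ⟨s, y⟩ := x
  simp only at hx hx1 hy ⊢
  have hA : s ^ (4 * k) / C + (s ^ (2 * k)) ^ 2 = s ^ (4 * k) * (1 + 1 / C) := by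
    rw [← pow_mul, show 2 * k * 2 = 4 * k by ring]; ring
  have hs : (s ^ (4 * k)) ^ (-(1 / (4 * (k:ℝ)))) = s⁻¹ := by
    rw [← Real.rpow_natCast, ← Real.rpow_mul hx.le, ← Real.rpow_neg_one]
    congr 1
    push_cast
    field_simp
  rw [hA, Real.mul_rpow (by positivity) (by positivity), hs]
  set a := (1 + 1 / C) ^ (-(1 / (4 * (k:ℝ))))
  set z := s ^ (2 * k - 1) with hz
  have hz0 : 0 < z := by positivity
  have hz1 : z ≤ 1 := pow_le_one₀ hx.le hx1
  have h2 : s ^ (2 * k) = s * z := by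
    rw [hz, ← pow_succ']; congr 1; omega
  have h4 : s ^ (4 * k - 1) = s * z ^ 2 := by
    rw [hz, ← pow_mul, ← pow_succ']; congr 1; omega
  rw [h2, h4]
  have hfac : C * (4 * (k:ℝ) - 1) / (2 * k) * (s * z) * (s⁻¹ * a)
      - 2 * k * z * ((4 * k - 1) * (s * z ^ 2) * (s⁻¹ * a) + 2)
      = z * ((C / (2 * k)) * ((4 * k - 1) * a) - 2 * k * ((4 * k - 1) * a * z ^ 2 + 2)) := by
    field_simp
  rw [hfac]
  refine mul_pos hz0 ?_
  have hCk : 4 * (k:ℝ) + 1 < C / (2 * k) := by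
    rw [lt_div_iff₀ (by positivity)]; linarith
  have hb : 0 < (4 * (k:ℝ) - 1) * a := mul_pos (by linarith) (by linarith)
  have h₁ := mul_lt_mul_of_pos_right hCk hb
  have hzz : z ^ 2 ≤ 1 := pow_le_one₀ hz0.le hz1
  have h₂ : 2 * (k:ℝ) * ((4 * k - 1) * a * z ^ 2) ≤ 2 * k * ((4 * k - 1) * a) := by
    exact mul_le_mul_of_nonneg_left (mul_le_of_le_one_right hb.le hzz) (by positivity)
  have h₃ : (4 * (k:ℝ) - 1) * (1 / 2) ≤ (4 * k - 1) * a :=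
    mul_le_mul_of_nonneg_left ha (by linarith)
  have h₄ : (2 * (k:ℝ) + 1) * ((4 * k - 1) * (1 / 2)) ≤ (2 * k + 1) * ((4 * k - 1) * a) :=
    mul_le_mul_of_nonneg_left h₃ (by linarith)
  nlinarith

/-- A function whose right derivative is positive wherever it takes the value `c` cannot
drop below `c`. -/
lemma le_of_hasDerivWithinAt_pos_of_eq {a b c : ℝ} (hab : a ≤ b) {f f' : ℝ → ℝ}
    (hf : ∀ t ∈ Set.Icc a b, HasDerivWithinAt f (f' t) (Set.Icc a b) t) (ha : c ≤ f a)
    (hpos : ∀ t ∈ Set.Ico a b, f t = c → 0 < f' t) : c ≤ f b :=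
  image_le_of_deriv_right_lt_deriv_boundary' (f := fun _ => c) (f' := fun _ => 0)
    continuousOn_const (fun _ _ => hasDerivWithinAt_const _ _ _) ha
    (fun t ht => (hf t ht).continuousWithinAt)
    (fun t ht => (hf t (Set.Ico_subset_Icc_self ht)).mono_of_mem_nhdsWithin
      (Icc_mem_nhdsGE_of_mem ht))
    (fun t ht h => hpos t ht h.symm) (Set.right_mem_Icc.2 hab)

/-- A backward gradient flow of `u` ending in `D` stays in `D` while its coordinates are
both strictly positive. -/
theorem backward_flow_stays_in_D (k : ℕ) (hk : 1 ≤ k) (C : ℝ)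
    (hC : 2 * (k:ℝ) * (4 * (k:ℝ) + 1) < C)
    (T : ℝ) (hT : 0 < T) (ξ : ℝ → ℝ × ℝ)
    (hflow : ∀ t ∈ Set.Icc (-T) (0:ℝ),
      HasDerivWithinAt ξ (gradU k C (ξ t)) (Set.Icc (-T) 0) t)
    (h0 : ξ 0 ∈ Dset k) :
    ∀ t ∈ Set.Ico (-T) (0:ℝ), 0 < (ξ t).1 → 0 < (ξ t).2 → ξ t ∈ Dset k := by
  have hk1 : (1:ℝ) ≤ k := by exact_mod_cast hk
  have hC0 : 0 < C := by nlinarith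
  have hsub : ∀ {a b : ℝ}, -T ≤ a → b ≤ 0 → ∀ t ∈ Set.Icc a b,
      HasDerivWithinAt ξ (gradU k C (ξ t)) (Set.Icc a b) t := fun ha hb t ht =>
    (hflow t ⟨ha.trans ht.1, ht.2.trans hb⟩).mono (Set.Icc_subset_Icc ha hb)
  have hmono : ∀ {a b : ℝ}, -T ≤ a → a ≤ b → b ≤ 0 → 0 < (ξ a).1 → (ξ a).1 ≤ (ξ b).1 :=
    fun ha hab hb hpos => le_of_hasDerivWithinAt_pos_of_eq hab (f := fun t => (ξ t).1)
      (fun t ht => (hsub ha hb t ht).fst) le_rfl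
      (fun t _ h => gradU_fst_pos k hk C hC0 _ (hpos.trans_eq h.symm))
  intro t ht hx hy
  obtain ⟨-, h01, -, h02⟩ := h0
  refine ⟨hx, (hmono ht.1 ht.2.le le_rfl hx).trans_lt h01, hy, ?_⟩
  by_contra! hge
  have hpos : ∀ s ∈ Set.Icc t 0, 0 < (ξ s).1 := fun s hs =>
    hx.trans_le (hmono ht.1 hs.1 hs.2 hx)
  have := le_of_hasDerivWithinAt_pos_of_eq (c := 0) ht.2.le
    (f := fun s => (ξ s).2 - (ξ s).1 ^ (2 * k))
    (f' := fun s => (gradU k C (ξ s)).2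
      - 2 * (k:ℝ) * (ξ s).1 ^ (2 * k - 1) * (gradU k C (ξ s)).1)
    (fun s hs => by
      have h := hsub ht.1 le_rfl s hs
      have h₁ : HasDerivWithinAt (fun r => (ξ r).1) (gradU k C (ξ s)).1 (Set.Icc t 0) s := h.fst
      have h₂ : HasDerivWithinAt (fun r => (ξ r).2) (gradU k C (ξ s)).2 (Set.Icc t 0) s := h.snd
      simpa using h₂.fun_sub (h₁.fun_pow (2 * k)))
    (sub_nonneg.2 hge)
    (fun s hs h => by
      have hs' := Set.Ico_subset_Icc_self hs
      exact gradU_outward k hk C hC _ (hpos s hs')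
        ((hmono (ht.1.trans hs.1) hs.2.le le_rfl (hpos s hs')).trans h01.le) (sub_eq_zero.1 h))
  exact (sub_neg.2 h02).not_ge this
end
end

section
/- Let T > 0 and let f : [0,T] → [0,∞) be a C¹ function with f(0) = 0 and f'(t) = 2 + C^{1/(4k)}(4k−1) f(t)^{4k−2} for all t ∈ [0,T]. Then the curve γ₁(t) = (f(t), 0) is a gradient flow of u, i.e., γ₁'(t) = ∇u(γ₁(t)) for all t ∈ [0,T]. -/
noncomputable section

/-- On the horizontal axis, `u(s,0) = C^{1/(4k)} |s|^{4k-1} + 2 s`. -/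
theorem uu_horizontal {k : ℕ} (hk : 1 ≤ k) {C : ℝ} (hC : 0 < C) (s : ℝ) :
    uu k C (s, 0) =
      C ^ ((1:ℝ) / (4 * (k:ℝ))) * |s| ^ (4 * (k:ℝ) - 1) + 2 * s := by
  have hk' : (1:ℝ) ≤ k := by exact_mod_cast hk
  have habs : s ^ (4 * k) = |s| ^ (4 * (k:ℝ)) := by
    rw [← (Even.mul_right (by decide) k : Even (4 * k)).pow_abs s, ← Real.rpow_natCast]
    push_cast
    rfl
  have hexp : 4 * (k:ℝ) * (1 - 1 / (4 * (k:ℝ))) = 4 * k - 1 := by field_simp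
  have hconst : C / C ^ ((1:ℝ) - 1 / (4 * (k:ℝ))) = C ^ ((1:ℝ) / (4 * (k:ℝ))) := by
    rw [Real.rpow_sub hC, Real.rpow_one]
    have := (Real.rpow_pos_of_pos hC ((1:ℝ) / (4 * (k:ℝ)))).ne'
    field_simp
  simp only [uu]
  rw [zero_pow two_ne_zero, add_zero, habs, Real.div_rpow (by positivity) hC.le,
    ← Real.rpow_mul (abs_nonneg s), hexp, ← hconst]
  ring

/-- The horizontal partial derivative of `u` on the nonnegative horizontal axis. -/
theorem hasDerivAt_uu_horizontal {k : ℕ} (hk : 1 ≤ k) {C : ℝ} (hC : 0 < C) {x : ℝ}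
    (hx : 0 ≤ x) :
    HasDerivAt (fun s => uu k C (s, 0))
      (2 + C ^ ((1:ℝ) / (4 * (k:ℝ))) * (4 * (k:ℝ) - 1) * x ^ (4 * k - 2)) x := by
  have hk' : (1:ℝ) ≤ k := by exact_mod_cast hk
  have hpow : |x| ^ (4 * (k:ℝ) - 1 - 2) * x = x ^ (4 * k - 2) := by
    obtain ⟨m, rfl⟩ := Nat.exists_eq_add_of_le' hk
    rw [abs_of_nonneg hx, show 4 * (((m + 1 : ℕ) : ℝ)) - 1 - 2 = ((4 * m + 1 : ℕ) : ℝ) by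
      push_cast; ring, Real.rpow_natCast, ← pow_succ]
    congr 1
  simp only [uu_horizontal hk hC]
  refine (((hasDerivAt_abs_rpow x (p := 4 * (k:ℝ) - 1) (by linarith)).const_mul
    (C ^ ((1:ℝ) / (4 * (k:ℝ))))).add ((hasDerivAt_id x).const_mul 2)).congr_deriv ?_
  rw [← hpow]
  ring

/-- The vertical partial derivative of `u` vanishes on the horizontal axis, by symmetry. -/
theorem deriv_uu_vertical (k : ℕ) (C x : ℝ) :
    deriv (fun s => uu k C (x, s)) 0 = 0 := by
  have h := deriv_comp_neg (fun s => uu k C (x, s)) 0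
  simp only [uu, neg_sq, neg_zero] at h ⊢
  linarith

/-- The curve γ₁(t) = (f(t), 0), where f solves f' = 2 + C^{1/(4k)}(4k-1) f^{4k-2} with
f(0) = 0, is a gradient flow of u. -/
theorem horizontal_curve_is_gradient_flow (k : ℕ) (hk : 1 ≤ k) (C : ℝ)
    (hC : 2 * (k:ℝ) * (4 * (k:ℝ) + 1) < C)
    (T : ℝ) (hT : 0 < T) (f : ℝ → ℝ)
    (hf_nonneg : ∀ t ∈ Set.Icc (0:ℝ) T, 0 ≤ f t)
    (hf0 : f 0 = 0)
    (hf' : ∀ t ∈ Set.Icc (0:ℝ) T,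
      HasDerivWithinAt f
        (2 + C ^ ((1:ℝ) / (4 * (k:ℝ))) * (4 * (k:ℝ) - 1) * f t ^ (4 * k - 2))
        (Set.Icc 0 T) t) :
    ∀ t ∈ Set.Icc (0:ℝ) T,
      HasDerivWithinAt (fun s => ((f s, (0:ℝ)) : ℝ × ℝ)) (gradU k C (f t, 0))
        (Set.Icc 0 T) t := by
  intro t ht
  have hC' : 0 < C := lt_of_le_of_lt (by positivity) hC
  have hgrad : gradU k C (f t, 0) =
      (2 + C ^ ((1:ℝ) / (4 * (k:ℝ))) * (4 * (k:ℝ) - 1) * f t ^ (4 * k - 2), 0) :=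
    Prod.ext (hasDerivAt_uu_horizontal hk hC' (hf_nonneg t ht)).deriv
      (deriv_uu_vertical k C (f t))
  rw [hgrad]
  exact (hf' t ht).prodMk (hasDerivWithinAt_const t _ 0)
end
end

section
/- The function u is continuously differentiable on ℝ², its gradient ∇u is Hölder continuous with exponent 1 − 1/(2k) on every bounded subset of ℝ², and u is twice continuously differentiable on ℝ² ∖ {(0,0)}. Moreover ∇u(0,0) = (2,0). -/
noncomputable section

open Real Set Filter Topology

section Profile

/-! ### The one-variable profile `y ↦ y (A + y²)^{-q}` -/

variable {A q : ℝ}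

lemma add_sq_rpow_neg_le_rpow (hA : 0 ≤ A) (hq : 0 < q) {y : ℝ} (hy : 0 < y) :
    (A + y ^ 2) ^ (-q) ≤ y ^ (-(2 * q)) := by
  have h : (A + y ^ 2) ^ (-q) ≤ (y ^ 2) ^ (-q) :=
    rpow_le_rpow_of_nonpos (by positivity) (by linarith) (by linarith)
  rwa [← rpow_natCast y, ← rpow_mul hy.le, Nat.cast_ofNat, mul_neg, rpow_ofNat] at h

lemma mul_rpow_neg_mono (hA : 0 ≤ A) (hq : 0 < q) (hq' : q ≤ 1 / 2) {y z : ℝ}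
    (hz : 0 < z) (hzy : z ≤ y) :
    z * (A + z ^ 2) ^ (-q) ≤ y * (A + y ^ 2) ^ (-q) := by
  have key : ∀ t : ℝ, 0 < t →
      t * (A + t ^ 2) ^ (-q) = t ^ (1 - 2 * q) * (t ^ 2 / (A + t ^ 2)) ^ q := by
    intro t ht
    have h2 : (t ^ 2) ^ q = t ^ (2 * q) := by
      rw [← rpow_natCast, ← rpow_mul ht.le, Nat.cast_ofNat]
    rw [div_rpow (by positivity) (by positivity), h2, rpow_neg (by positivity), div_eq_mul_inv,
      ← mul_assoc, ← rpow_add ht]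
    simp
  have hy : 0 < y := hz.trans_le hzy
  rw [key z hz, key y hy]
  have hdiv : z ^ 2 / (A + z ^ 2) ≤ y ^ 2 / (A + y ^ 2) := by
    have : z ^ 2 ≤ y ^ 2 := by gcongr
    rw [div_le_div_iff₀ (by positivity) (by positivity)]
    nlinarith
  have : 0 ≤ 1 - 2 * q := by linarith
  gcongr

lemma sub_mul_rpow_neg_le (hA : 0 ≤ A) (hq : 0 < q) (hq' : q < 1 / 2) {y z : ℝ}
    (hz : 0 ≤ z) (hzy : z ≤ y) :
    |y * (A + y ^ 2) ^ (-q) - z * (A + z ^ 2) ^ (-q)| ≤ (y - z) ^ (1 - 2 * q) := by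
  rcases hzy.eq_or_lt with rfl | hlt
  · simp [zero_rpow (by linarith : (1 - 2 * q) ≠ 0)]
  have hy : 0 < y := hz.trans_lt hlt
  have hd : 0 < y - z := sub_pos.2 hlt
  have hmono : z * (A + z ^ 2) ^ (-q) ≤ y * (A + y ^ 2) ^ (-q) := by
    rcases hz.eq_or_lt with rfl | hz
    · rw [zero_mul]; positivity
    · exact mul_rpow_neg_mono hA hq hq'.le hz hzy
  have hanti : z * (A + y ^ 2) ^ (-q) ≤ z * (A + z ^ 2) ^ (-q) := by
    rcases hz.eq_or_lt with rfl | hz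
    · simp
    · exact mul_le_mul_of_nonneg_left
        (rpow_le_rpow_of_nonpos (by positivity) (by gcongr) (by linarith)) hz.le
  rw [abs_of_nonneg (sub_nonneg.2 hmono)]
  calc y * (A + y ^ 2) ^ (-q) - z * (A + z ^ 2) ^ (-q)
      ≤ (y - z) * (A + y ^ 2) ^ (-q) := by linarith
    _ ≤ (y - z) * (y - z) ^ (-(2 * q)) := by
        gcongr
        exact (add_sq_rpow_neg_le_rpow hA hq hy).trans
          (rpow_le_rpow_of_nonpos hd (by linarith) (by linarith))
    _ = (y - z) ^ (1 - 2 * q) := by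
        rw [sub_eq_add_neg 1, rpow_add hd, rpow_one]

lemma abs_sub_mul_rpow_neg_le (hA : 0 ≤ A) (hq : 0 < q) (hq' : q < 1 / 2) (y z : ℝ) :
    |y * (A + y ^ 2) ^ (-q) - z * (A + z ^ 2) ^ (-q)| ≤ 2 * |y - z| ^ (1 - 2 * q) := by
  wlog hzy : z ≤ y generalizing y z
  · rw [abs_sub_comm, abs_sub_comm y]
    exact this z y (le_of_not_ge hzy)
  rw [abs_of_nonneg (sub_nonneg.2 hzy)]
  have hβ : 0 ≤ 1 - 2 * q := by linarith
  have hpos : 0 ≤ (y - z) ^ (1 - 2 * q) := rpow_nonneg (sub_nonneg.2 hzy) _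
  rcases le_total 0 z with hz | hz
  · linarith [sub_mul_rpow_neg_le hA hq hq' hz hzy]
  rcases le_total y 0 with hy | hy
  · have h := sub_mul_rpow_neg_le hA hq hq' (neg_nonneg.2 hy) (neg_le_neg hzy)
    simp only [even_two, Even.neg_pow, neg_mul, sub_neg_eq_add] at h
    rw [neg_add_eq_sub, neg_add_eq_sub] at h
    linarith
  · have h1 := sub_mul_rpow_neg_le hA hq hq' le_rfl hy
    have h2 := sub_mul_rpow_neg_le hA hq hq' le_rfl (neg_nonneg.2 hz)
    simp only [even_two, Even.neg_pow, neg_mul, zero_mul, sub_zero, abs_neg] at h1 h2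
    have h3 : y ^ (1 - 2 * q) ≤ (y - z) ^ (1 - 2 * q) := rpow_le_rpow hy (by linarith) hβ
    have h4 : (-z) ^ (1 - 2 * q) ≤ (y - z) ^ (1 - 2 * q) := 
      rpow_le_rpow (neg_nonneg.2 hz) (by linarith) hβ
    linarith [abs_sub (y * (A + y ^ 2) ^ (-q)) (z * (A + z ^ 2) ^ (-q))]

end Profile

/-- The base `x^{4k}/C + y²` of the power in `uu`. -/
def potBase (k : ℕ) (C x y : ℝ) : ℝ := x ^ (4 * k) / C + y ^ 2

/-- The weight `(x^{4k}/C + y²)^{-1/(4k)}` of both partial derivatives of `uu`. -/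
def potWeight (k : ℕ) (C x y : ℝ) : ℝ := potBase k C x y ^ (-(1 / (4 * (k : ℝ))))

section Bounds

variable {k : ℕ} {C : ℝ}

lemma pow_four_mul_nonneg (x : ℝ) : 0 ≤ x ^ (4 * k) :=
  Even.pow_nonneg ⟨2 * k, by ring⟩ x

lemma potBase_nonneg (hC : 0 < C) (x y : ℝ) : 0 ≤ potBase k C x y :=
  add_nonneg (div_nonneg (pow_four_mul_nonneg x) hC.le) (sq_nonneg y)

lemma potBase_pos_of_right (hC : 0 < C) (x : ℝ) {y : ℝ} (hy : y ≠ 0) : 0 < potBase k C x y :=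
  add_pos_of_nonneg_of_pos (div_nonneg (pow_four_mul_nonneg x) hC.le) (by positivity)

lemma potBase_pos_of_left (hC : 0 < C) {x : ℝ} (y : ℝ) (hx : x ≠ 0) : 0 < potBase k C x y :=
  add_pos_of_pos_of_nonneg
    (div_pos ((pow_four_mul_nonneg x).lt_of_ne' (pow_ne_zero _ hx)) hC) (sq_nonneg y)

lemma potBase_pos (hC : 0 < C) {p : ℝ × ℝ} (hp : p ≠ 0) : 0 < potBase k C p.1 p.2 := by
  by_cases h : p.1 = 0
  · exact potBase_pos_of_right hC _ fun h' => hp (Prod.ext h h')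
  · exact potBase_pos_of_left hC _ h

lemma potWeight_nonneg (hC : 0 < C) (x y : ℝ) : 0 ≤ potWeight k C x y :=
  rpow_nonneg (potBase_nonneg hC x y) _

lemma abs_mul_potWeight_le (hk : 1 ≤ k) (hC : 0 < C) (x y : ℝ) :
    |x| * potWeight k C x y ≤ C ^ (1 / (4 * (k : ℝ))) := by
  rcases eq_or_ne x 0 with rfl | hx
  · simp only [abs_zero, zero_mul]; positivity
  have hk' : (k : ℝ) ≠ 0 := by positivity
  have hx' : 0 < |x| := abs_pos.2 hx
  have hle : |x| ^ (4 * k) / C ≤ potBase k C x y := by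
    rw [Even.pow_abs ⟨2 * k, by ring⟩, potBase]
    linarith [sq_nonneg y]
  have hw : potWeight k C x y ≤ (|x| ^ (4 * k) / C) ^ (-(1 / (4 * (k : ℝ)))) :=
    rpow_le_rpow_of_nonpos (by positivity) hle (by rw [neg_nonpos]; positivity)
  have heq : (|x| ^ (4 * k) / C) ^ (-(1 / (4 * (k : ℝ)))) = |x|⁻¹ * C ^ (1 / (4 * (k : ℝ))) := by
    rw [rpow_neg (by positivity), div_rpow (by positivity) hC.le, ← rpow_natCast,
      ← rpow_mul hx'.le, inv_div, div_eq_inv_mul]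
    congr 2
    push_cast
    rw [mul_one_div_cancel (by positivity), rpow_one]
  rw [heq] at hw
  calc |x| * potWeight k C x y ≤ |x| * (|x|⁻¹ * C ^ (1 / (4 * (k : ℝ)))) := by gcongr
    _ = C ^ (1 / (4 * (k : ℝ))) := by rw [mul_inv_cancel_left₀ hx'.ne']

lemma pow_mul_potWeight_le (hk : 1 ≤ k) (hC : 0 < C) {R x : ℝ} (hx : |x| ≤ R) (y : ℝ) :
    |x| ^ (4 * k - 2) * potWeight k C x y ≤ R ^ (4 * k - 3) * C ^ (1 / (4 * (k : ℝ))) := by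
  have hR : 0 ≤ R := (abs_nonneg x).trans hx
  calc |x| ^ (4 * k - 2) * potWeight k C x y
      = |x| ^ (4 * k - 3) * (|x| * potWeight k C x y) := by
        rw [← mul_assoc, ← pow_succ]; congr 2; omega
    _ ≤ R ^ (4 * k - 3) * C ^ (1 / (4 * (k : ℝ))) := by
        have := abs_mul_potWeight_le hk hC x y
        have := potWeight_nonneg (k := k) hC x y
        gcongr

lemma pow_mul_abs_le_potBase (hC : 1 ≤ C) (x y : ℝ) :
    |x| ^ (2 * k) * |y| ≤ C * potBase k C x y := by
  have h1 : (|x| ^ (2 * k)) ^ 2 = x ^ (4 * k) := by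
    rw [← pow_mul, ← Even.pow_abs ⟨2 * k, by ring⟩ x]; congr 1; ring
  have h2 : C * potBase k C x y = x ^ (4 * k) + C * y ^ 2 := by
    rw [potBase]; field_simp
  rw [h2, ← h1, ← sq_abs y]
  nlinarith [sq_nonneg (|x| ^ (2 * k) - |y|), sq_nonneg |y|, sq_nonneg (|x| ^ (2 * k))]

/-- The bound for both mixed derivatives. -/
lemma pow_mul_potWeight_div_le (hk : 1 ≤ k) (hC : 1 ≤ C) {R x y : ℝ} (hx : |x| ≤ R)
    (hpos : 0 < potBase k C x y) :
    |x| ^ (4 * k - 1) * |y| * (potWeight k C x y / potBase k C x y) ≤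
      R ^ (2 * k - 2) * C ^ (1 / (4 * (k : ℝ))) * C := by
  have hC0 : 0 < C := by linarith
  have hR : 0 ≤ R := (abs_nonneg x).trans hx
  have hdiv : |x| ^ (2 * k) * |y| / potBase k C x y ≤ C := by
    rw [div_le_iff₀ hpos]; exact pow_mul_abs_le_potBase hC x y
  calc |x| ^ (4 * k - 1) * |y| * (potWeight k C x y / potBase k C x y)
      = |x| ^ (2 * k - 2) * (|x| * potWeight k C x y) *
          (|x| ^ (2 * k) * |y| / potBase k C x y) := by
        rw [show 4 * k - 1 = (2 * k - 2) + 1 + 2 * k by omega, pow_add, pow_add]; ring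
    _ ≤ R ^ (2 * k - 2) * C ^ (1 / (4 * (k : ℝ))) * C := by
        have := abs_mul_potWeight_le hk hC0 x y
        have := potWeight_nonneg (k := k) hC0 x y
        gcongr

end Bounds

section Lipschitz

variable {k : ℕ} {C : ℝ}

lemma rpow_neg_sub_one_potBase {x y : ℝ} (hpos : 0 < potBase k C x y) :
    potBase k C x y ^ (-(1 / (4 * (k : ℝ))) - 1) = potWeight k C x y / potBase k C x y := by
  rw [rpow_sub_one hpos.ne', potWeight]

lemma hasDerivAt_potWeight_left (hk : 1 ≤ k) {x y : ℝ} (hpos : 0 < potBase k C x y) :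
    HasDerivAt (fun s => potWeight k C s y)
      (-(x ^ (4 * k - 1) / C * (potWeight k C x y / potBase k C x y))) x := by
  have hk' : (k : ℝ) ≠ 0 := by positivity
  have hb : HasDerivAt (fun s => potBase k C s y) ((4 * k : ℕ) * x ^ (4 * k - 1) / C) x :=
    ((hasDerivAt_pow (4 * k) x).div_const C).add_const _
  refine (hb.rpow_const (p := -(1 / (4 * (k : ℝ)))) (Or.inl hpos.ne')).congr_deriv ?_
  rw [rpow_neg_sub_one_potBase hpos]
  push_cast
  field_simp

lemma hasDerivAt_potWeight_right {x y : ℝ} (hpos : 0 < potBase k C x y) :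
    HasDerivAt (fun s => potWeight k C x s)
      (-(2 / (4 * (k : ℝ)) * y * (potWeight k C x y / potBase k C x y))) y := by
  have hb : HasDerivAt (fun s => potBase k C x s) (2 * y) y := by
    simpa [potBase] using (hasDerivAt_pow 2 y).const_add (x ^ (4 * k) / C)
  refine (hb.rpow_const (p := -(1 / (4 * (k : ℝ)))) (Or.inl hpos.ne')).congr_deriv ?_
  rw [rpow_neg_sub_one_potBase hpos]
  ring

lemma abs_sub_le_of_hasDerivAt {f f' : ℝ → ℝ} {R K : ℝ}
    (hf : ∀ t, |t| ≤ R → HasDerivAt f (f' t) t) (hb : ∀ t, |t| ≤ R → |f' t| ≤ K)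
    {s t : ℝ} (hs : |s| ≤ R) (ht : |t| ≤ R) : |f s - f t| ≤ K * |s - t| :=
  (convex_Icc (-R) R).norm_image_sub_le_of_norm_hasDerivWithin_le
    (fun x hx => (hf x (abs_le.2 hx)).hasDerivWithinAt) (fun x hx => hb x (abs_le.2 hx))
    (abs_le.1 ht) (abs_le.1 hs)

lemma exists_lipschitz_mul_potWeight_left (hk : 1 ≤ k) (hC : 1 ≤ C) (R : ℝ) :
    ∃ K, 0 ≤ K ∧ ∀ x x' y : ℝ, |x| ≤ R → |x'| ≤ R →
      |y * potWeight k C x y - y * potWeight k C x' y| ≤ K * |x - x'| := by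
  have hC0 : 0 < C := by linarith
  refine ⟨|R| ^ (2 * k - 2) * C ^ (1 / (4 * (k : ℝ))) * C, by positivity, ?_⟩
  intro x x' y hx hx'
  rcases eq_or_ne y 0 with rfl | hy
  · simp only [zero_mul, sub_zero, abs_zero]; positivity
  refine abs_sub_le_of_hasDerivAt (R := |R|) (fun t _ => (hasDerivAt_potWeight_left hk
    (potBase_pos_of_right hC0 t hy)).const_mul y) (fun t ht => ?_)
    (hx.trans (le_abs_self R)) (hx'.trans (le_abs_self R))
  have hpos := potBase_pos_of_right (k := k) hC0 t hy
  have hw : 0 ≤ potWeight k C t y / potBase k C t y :=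
    div_nonneg (potWeight_nonneg hC0 t y) hpos.le
  refine le_trans ?_ (pow_mul_potWeight_div_le hk hC ht hpos)
  rw [abs_mul, abs_neg, abs_mul, abs_div, abs_pow, abs_of_nonneg hw, abs_of_pos hC0]
  calc |y| * (|t| ^ (4 * k - 1) / C * (potWeight k C t y / potBase k C t y))
      ≤ |y| * (|t| ^ (4 * k - 1) * (potWeight k C t y / potBase k C t y)) := by
        gcongr
        exact div_le_self (by positivity) hC
    _ = _ := by ring

lemma exists_lipschitz_pow_mul_potWeight_right (hk : 1 ≤ k) (hC : 1 ≤ C) (R : ℝ) :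
    ∃ K, 0 ≤ K ∧ ∀ x y y' : ℝ, |x| ≤ R →
      |x ^ (4 * k - 1) * potWeight k C x y - x ^ (4 * k - 1) * potWeight k C x y'| ≤
        K * |y - y'| := by
  have hC0 : 0 < C := by linarith
  refine ⟨|R| ^ (2 * k - 2) * C ^ (1 / (4 * (k : ℝ))) * C, by positivity, ?_⟩
  intro x y y' hx
  rcases eq_or_ne x 0 with rfl | hx0
  · rw [zero_pow (by omega)]; simp only [zero_mul, sub_zero, abs_zero]; positivity
  refine abs_sub_le_of_hasDerivAt (R := max |y| |y'|) (fun t _ => (hasDerivAt_potWeight_right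
    (potBase_pos_of_left hC0 t hx0)).const_mul (x ^ (4 * k - 1))) (fun t _ => ?_)
    (le_max_left _ _) (le_max_right _ _)
  have hpos := potBase_pos_of_left (k := k) hC0 t hx0
  have hw : 0 ≤ potWeight k C x t / potBase k C x t :=
    div_nonneg (potWeight_nonneg hC0 x t) hpos.le
  refine le_trans ?_ (pow_mul_potWeight_div_le hk hC (hx.trans (le_abs_self R)) hpos)
  have hk1 : (1 : ℝ) ≤ k := by exact_mod_cast hk
  have h2 : 2 / (4 * (k : ℝ)) ≤ 1 := by rw [div_le_one (by positivity)]; linarith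
  rw [abs_mul, abs_neg, abs_mul, abs_mul, abs_pow, abs_of_nonneg hw,
    abs_of_nonneg (by positivity : 0 ≤ 2 / (4 * (k : ℝ))), mul_assoc (|x| ^ (4 * k - 1))]
  gcongr
  exact mul_le_of_le_one_left (abs_nonneg t) h2

lemma exists_lipschitz_pow_mul_potWeight_left (hk : 1 ≤ k) (hC : 1 ≤ C) (R : ℝ) :
    ∃ K, 0 ≤ K ∧ ∀ x x' y : ℝ, |x| ≤ R → |x'| ≤ R →
      |x ^ (4 * k - 1) * potWeight k C x y - x' ^ (4 * k - 1) * potWeight k C x' y| ≤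
        K * |x - x'| := by
  have hC0 : 0 < C := by linarith
  set D := |R| ^ (4 * k - 3) * C ^ (1 / (4 * (k : ℝ))) with hD
  have hD0 : 0 ≤ D := by positivity
  refine ⟨((4 * k : ℕ) + 1) * D, by positivity, ?_⟩
  intro x x' y hx hx'
  have hne : ∀ y : ℝ, y ≠ 0 →
      |x ^ (4 * k - 1) * potWeight k C x y - x' ^ (4 * k - 1) * potWeight k C x' y| ≤
        ((4 * k : ℕ) + 1) * D * |x - x'| := by
    intro y hy
    refine abs_sub_le_of_hasDerivAt (R := |R|) (fun t _ => (hasDerivAt_pow (4 * k - 1) t).mul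
      (hasDerivAt_potWeight_left hk (potBase_pos_of_right hC0 t hy))) (fun t ht => ?_)
      (hx.trans (le_abs_self R)) (hx'.trans (le_abs_self R))
    have hpos := potBase_pos_of_right (k := k) hC0 t hy
    have hw := potWeight_nonneg (k := k) hC0 t y
    have hbound := pow_mul_potWeight_le hk hC0 ht y
    have hfrac : t ^ (4 * k) / C / potBase k C t y ≤ 1 := by
      rw [div_le_one hpos, potBase]; linarith [sq_nonneg y]
    have hfrac0 : 0 ≤ t ^ (4 * k) / C / potBase k C t y :=
      div_nonneg (div_nonneg (pow_four_mul_nonneg t) hC0.le) hpos.le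
    have hsplit : t ^ (4 * k - 1) * -(t ^ (4 * k - 1) / C *
          (potWeight k C t y / potBase k C t y)) =
        -(t ^ (4 * k - 2) * potWeight k C t y * (t ^ (4 * k) / C / potBase k C t y)) := by
      have : t ^ (4 * k - 1) * t ^ (4 * k - 1) = t ^ (4 * k - 2) * t ^ (4 * k) := by
        rw [← pow_add, ← pow_add]; congr 1; omega
      linear_combination (-(potWeight k C t y / potBase k C t y / C)) * this
    rw [hsplit]
    have hsub : 4 * k - 1 - 1 = 4 * k - 2 := by omega
    have hcast : ((4 * k - 1 : ℕ) : ℝ) ≤ (4 * k : ℕ) := by exact_mod_cast Nat.sub_le _ _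
    refine (abs_add_le _ _).trans ?_
    rw [abs_neg, hsub, abs_mul, abs_mul, abs_mul, abs_mul, abs_pow, abs_of_nonneg hw,
      abs_of_nonneg hfrac0, Nat.abs_cast, mul_assoc, add_mul, one_mul]
    refine add_le_add (mul_le_mul hcast hbound (by positivity) (by positivity)) ?_
    exact (mul_le_of_le_one_right (by positivity) hfrac).trans hbound
  obtain ⟨K, -, hK⟩ := exists_lipschitz_pow_mul_potWeight_right hk hC R
  have hcont : ∀ x : ℝ, |x| ≤ R →
      Continuous fun y => x ^ (4 * k - 1) * potWeight k C x y := fun x hx =>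
    (LipschitzWith.of_dist_le' fun y y' => hK x y y' hx).continuous
  have hclosed : IsClosed {y : ℝ |
      |x ^ (4 * k - 1) * potWeight k C x y - x' ^ (4 * k - 1) * potWeight k C x' y| ≤
        ((4 * k : ℕ) + 1) * D * |x - x'|} :=
    isClosed_le (((hcont x hx).sub (hcont x' hx')).abs) continuous_const
  exact hclosed.closure_subset_iff.2 (fun y (hy : y ∈ ({0}ᶜ : Set ℝ)) => hne y hy)
    (dense_compl_singleton (0 : ℝ) y)

lemma le_mul_rpow_of_le {M d β : ℝ} (hd : 0 ≤ d) (hdM : d ≤ M) (hβ : 0 < β) (hβ1 : β ≤ 1) :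
    d ≤ M ^ (1 - β) * d ^ β := by
  rcases hd.eq_or_lt with rfl | hd
  · rw [zero_rpow hβ.ne', mul_zero]
  calc d = d ^ (1 - β) * d ^ β := by rw [← rpow_add hd]; simp
    _ ≤ M ^ (1 - β) * d ^ β := by
      have : 0 ≤ 1 - β := by linarith
      gcongr

/-- The nontrivial part of the gradient of `uu`, up to constant factors. -/
def gradCore (k : ℕ) (C : ℝ) (p : ℝ × ℝ) : ℝ × ℝ :=
  (p.1 ^ (4 * k - 1) * potWeight k C p.1 p.2, p.2 * potWeight k C p.1 p.2)

lemma exists_holder_gradCore (hk : 1 ≤ k) (hC : 1 ≤ C) (R : ℝ) :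
    ∃ K, ∀ p q : ℝ × ℝ, ‖p‖ ≤ R → ‖q‖ ≤ R →
      ‖gradCore k C p - gradCore k C q‖ ≤ K * ‖p - q‖ ^ (1 - 1 / (2 * (k : ℝ))) := by
  have hC0 : 0 < C := by linarith
  have hk1 : (1 : ℝ) ≤ k := by exact_mod_cast hk
  obtain ⟨K₁, hK₁, h₁⟩ := exists_lipschitz_pow_mul_potWeight_left hk hC R
  obtain ⟨K₂, hK₂, h₂⟩ := exists_lipschitz_pow_mul_potWeight_right hk hC R
  obtain ⟨K₃, hK₃, h₃⟩ := exists_lipschitz_mul_potWeight_left hk hC R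
  set β : ℝ := 1 - 1 / (2 * (k : ℝ)) with hβdef
  have hhalf : 1 / (2 * (k : ℝ)) ≤ 1 / 2 := by gcongr; linarith
  have hhalf0 : 0 < 1 / (2 * (k : ℝ)) := by positivity
  have hβ : 0 < β := by linarith
  have hβ1 : β ≤ 1 := by linarith
  have hquarter : 2 * (1 / (4 * (k : ℝ))) = 1 / (2 * (k : ℝ)) := by field_simp; norm_num
  refine ⟨(K₁ + K₂ + K₃) * (2 * R) ^ (1 - β) + 2, fun p q hp hq => ?_⟩
  have hp1 : |p.1| ≤ R := (norm_fst_le p).trans hp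
  have hq1 : |q.1| ≤ R := (norm_fst_le q).trans hq
  have hd1 : |p.1 - q.1| ≤ ‖p - q‖ := norm_fst_le (p - q)
  have hd2 : |p.2 - q.2| ≤ ‖p - q‖ := norm_snd_le (p - q)
  have hR : 0 ≤ R := (norm_nonneg p).trans hp
  have hd : ‖p - q‖ ≤ (2 * R) ^ (1 - β) * ‖p - q‖ ^ β :=
    le_mul_rpow_of_le (norm_nonneg _) ((norm_sub_le p q).trans (by linarith)) hβ hβ1
  have hpow : 0 ≤ ‖p - q‖ ^ β := by positivity
  have hE : 0 ≤ (2 * R) ^ (1 - β) * ‖p - q‖ ^ β := by positivity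
  set E := (2 * R) ^ (1 - β) * ‖p - q‖ ^ β with hEdef
  have hrhs : ((K₁ + K₂ + K₃) * (2 * R) ^ (1 - β) + 2) * ‖p - q‖ ^ β =
      K₁ * E + K₂ * E + K₃ * E + 2 * ‖p - q‖ ^ β := by rw [hEdef]; ring
  have hscale : ∀ {K e : ℝ}, 0 ≤ K → e ≤ ‖p - q‖ → K * e ≤ K * E := fun hK he =>
    mul_le_mul_of_nonneg_left (he.trans hd) hK
  have hnn : ∀ {K : ℝ}, 0 ≤ K → 0 ≤ K * E := fun hK => mul_nonneg hK hE
  rw [hrhs, Prod.norm_def, max_le_iff]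
  constructor
  · calc |p.1 ^ (4 * k - 1) * potWeight k C p.1 p.2 - q.1 ^ (4 * k - 1) * potWeight k C q.1 q.2|
        ≤ K₁ * |p.1 - q.1| + K₂ * |p.2 - q.2| :=
          (abs_sub_le _ (q.1 ^ (4 * k - 1) * potWeight k C q.1 p.2) _).trans
            (add_le_add (h₁ _ _ _ hp1 hq1) (h₂ _ _ _ hq1))
      _ ≤ _ := by linarith [hscale hK₁ hd1, hscale hK₂ hd2, hnn hK₃]
  · have hy : |p.2 * potWeight k C q.1 p.2 - q.2 * potWeight k C q.1 q.2| ≤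
        2 * |p.2 - q.2| ^ β := by
      have := abs_sub_mul_rpow_neg_le (div_nonneg (pow_four_mul_nonneg (k := k) q.1) hC0.le)
        (q := 1 / (4 * (k : ℝ))) (by positivity) (by linarith) p.2 q.2
      rwa [hquarter] at this
    calc |p.2 * potWeight k C p.1 p.2 - q.2 * potWeight k C q.1 q.2|
        ≤ K₃ * |p.1 - q.1| + 2 * |p.2 - q.2| ^ β :=
          (abs_sub_le _ (p.2 * potWeight k C q.1 p.2) _).trans
            (add_le_add (h₃ _ _ _ hp1 hq1) hy)
      _ ≤ K₃ * |p.1 - q.1| + 2 * ‖p - q‖ ^ β := by gcongr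
      _ ≤ _ := by linarith [hscale hK₃ hd1, hnn hK₁, hnn hK₂]

lemma continuous_gradCore (hk : 1 ≤ k) (hC : 1 ≤ C) : Continuous (gradCore k C) := by
  have hk1 : (1 : ℝ) ≤ k := by exact_mod_cast hk
  have hhalf : 1 / (2 * (k : ℝ)) ≤ 1 / 2 := by gcongr; linarith
  have hβ : 0 < 1 - 1 / (2 * (k : ℝ)) := by linarith
  refine continuous_iff_continuousAt.2 fun p => ?_
  obtain ⟨K, hK⟩ := exists_holder_gradCore hk hC (‖p‖ + 1)
  refine tendsto_iff_norm_sub_tendsto_zero.2 (squeeze_zero' (.of_forall fun _ => norm_nonneg _)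
    (g := fun q => K * ‖q - p‖ ^ (1 - 1 / (2 * (k : ℝ)))) ?_ ?_)
  · filter_upwards [Metric.ball_mem_nhds p one_pos] with q hq
    refine hK q p ?_ (by linarith)
    rw [mem_ball_iff_norm] at hq
    linarith [norm_le_norm_add_norm_sub' q p]
  · have : Continuous fun q : ℝ × ℝ => K * ‖q - p‖ ^ (1 - 1 / (2 * (k : ℝ))) :=
      continuous_const.mul ((continuous_id.sub continuous_const).norm.rpow_const
        fun _ => Or.inr hβ.le)
    convert this.tendsto p using 2
    rw [sub_self, norm_zero, zero_rpow hβ.ne', mul_zero]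

end Lipschitz

section Derivative

variable {k : ℕ} {C : ℝ}

/-- The gradient of `uu` in closed form. -/
def gradFormula (k : ℕ) (C : ℝ) (p : ℝ × ℝ) : ℝ × ℝ :=
  ((4 * k - 1) * (gradCore k C p).1 + 2, 2 * C * (1 - 1 / (4 * (k : ℝ))) * (gradCore k C p).2)

/-- The linear functional with coefficients `v`. -/
def functionalOf (v : ℝ × ℝ) : ℝ × ℝ →L[ℝ] ℝ :=
  v.1 • ContinuousLinearMap.fst ℝ ℝ ℝ + v.2 • ContinuousLinearMap.snd ℝ ℝ ℝ

lemma uu_eq (p : ℝ × ℝ) :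
    uu k C p = C * potBase k C p.1 p.2 ^ ((1 : ℝ) - 1 / (4 * (k : ℝ))) + 2 * p.1 := rfl

lemma potBase_rpow_eq (hk : 1 ≤ k) (hC : 0 < C) (p : ℝ × ℝ) :
    C * potBase k C p.1 p.2 ^ ((1 : ℝ) - 1 / (4 * (k : ℝ))) =
      (gradCore k C p).1 * p.1 + C * ((gradCore k C p).2 * p.2) := by
  have hk1 : (1 : ℝ) ≤ k := by exact_mod_cast hk
  have hexp : 1 / (4 * (k : ℝ)) < 1 := by rw [div_lt_one (by positivity)]; linarith
  have hpow : p.1 ^ (4 * k) = p.1 ^ (4 * k - 1) * p.1 := by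
    rw [← pow_succ]; congr 1; omega
  have hmul : potBase k C p.1 p.2 ^ ((1 : ℝ) - 1 / (4 * (k : ℝ))) =
      potBase k C p.1 p.2 * potWeight k C p.1 p.2 := by
    rcases (potBase_nonneg (k := k) hC p.1 p.2).eq_or_lt with h | h
    · rw [← h, zero_rpow (by linarith), zero_mul]
    · rw [sub_eq_add_neg, rpow_add h, rpow_one, potWeight]
  rw [hmul]
  simp only [gradCore]
  nth_rw 1 [potBase]
  rw [hpow]
  field_simp

lemma gradCore_zero (hk : 1 ≤ k) : gradCore k C 0 = 0 := by
  have : 4 * k - 1 ≠ 0 := by omega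
  simp [gradCore, this]

lemma hasFDerivAt_uu_zero (hk : 1 ≤ k) (hC : 1 ≤ C) :
    HasFDerivAt (uu k C) (functionalOf (gradFormula k C 0)) 0 := by
  have hcont := (continuous_gradCore hk hC).tendsto 0
  rw [gradCore_zero hk] at hcont
  have h1 : (fun p => (gradCore k C p).1) =o[𝓝 0] fun _ => (1 : ℝ) :=
    (Asymptotics.isLittleO_one_iff ℝ).2 ((continuous_fst.tendsto _).comp hcont)
  have h2 : (fun p => (gradCore k C p).2) =o[𝓝 0] fun _ => (1 : ℝ) :=
    (Asymptotics.isLittleO_one_iff ℝ).2 ((continuous_snd.tendsto _).comp hcont)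
  have h3 := (h1.mul_isBigO (Asymptotics.isBigO_refl (fun p : ℝ × ℝ => p.1) _)).trans_isBigO
    (k := fun p : ℝ × ℝ => p) (by simpa using Asymptotics.isBigO_fst_prod')
  have h4 := (h2.mul_isBigO (Asymptotics.isBigO_refl (fun p : ℝ × ℝ => p.2) _)).trans_isBigO
    (k := fun p : ℝ × ℝ => p) (by simpa using Asymptotics.isBigO_snd_prod')
  rw [hasFDerivAt_iff_isLittleO_nhds_zero]
  refine (h3.add (h4.const_mul_left C)).congr_left fun p => ?_
  have h0 : uu k C 0 = 0 := by
    rw [uu_eq, potBase_rpow_eq hk (by linarith), gradCore_zero hk]; simp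
  rw [zero_add, h0, uu_eq, potBase_rpow_eq hk (by linarith)]
  simp [functionalOf, gradFormula, gradCore_zero hk]

lemma hasFDerivAt_uu_of_ne (hk : 1 ≤ k) (hC : 1 ≤ C) {p : ℝ × ℝ} (hp : p ≠ 0) :
    HasFDerivAt (uu k C) (functionalOf (gradFormula k C p)) p := by
  have hC0 : 0 < C := by linarith
  have hk' : (k : ℝ) ≠ 0 := by positivity
  have hpos := potBase_pos (k := k) hC0 hp
  have hb : HasFDerivAt (fun q : ℝ × ℝ => potBase k C q.1 q.2)
      (functionalOf ((4 * k : ℕ) * p.1 ^ (4 * k - 1) / C, 2 * p.2)) p := by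
    have hx : HasFDerivAt (fun q : ℝ × ℝ => q.1 ^ (4 * k) / C) _ p :=
      ((hasDerivAt_pow (4 * k) p.1).div_const C).comp_hasFDerivAt p
        (hasFDerivAt_fst (𝕜 := ℝ) (p := p))
    have hy : HasFDerivAt (fun q : ℝ × ℝ => q.2 ^ 2) _ p :=
      (hasDerivAt_pow 2 p.2).comp_hasFDerivAt p (hasFDerivAt_snd (𝕜 := ℝ) (p := p))
    exact (hx.add hy).congr_fderiv (by simp [functionalOf])
  have h := ((hb.rpow_const (p := (1 : ℝ) - 1 / (4 * (k : ℝ))) (Or.inl hpos.ne')).const_mul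
    C).add ((hasFDerivAt_fst (𝕜 := ℝ) (p := p)).const_mul (2 : ℝ))
  refine h.congr_fderiv ?_
  have hexp : (1 : ℝ) - 1 / (4 * (k : ℝ)) - 1 = -(1 / (4 * (k : ℝ))) := by ring
  rw [hexp]
  change C • (((1 : ℝ) - 1 / (4 * (k : ℝ))) * potWeight k C p.1 p.2) • _ + _ = _
  ext <;> simp [functionalOf, gradFormula, gradCore] <;> field_simp

lemma hasFDerivAt_uu (hk : 1 ≤ k) (hC : 1 ≤ C) (p : ℝ × ℝ) :
    HasFDerivAt (uu k C) (functionalOf (gradFormula k C p)) p := by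
  rcases eq_or_ne p 0 with rfl | hp
  · exact hasFDerivAt_uu_zero hk hC
  · exact hasFDerivAt_uu_of_ne hk hC hp

lemma gradU_eq_s8 (hk : 1 ≤ k) (hC : 1 ≤ C) (p : ℝ × ℝ) : gradU k C p = gradFormula k C p := by
  have h := hasFDerivAt_uu hk hC p
  have hx := h.comp_hasDerivAt p.1 ((hasDerivAt_id p.1).prodMk (hasDerivAt_const p.1 p.2))
  have hy := h.comp_hasDerivAt p.2 ((hasDerivAt_const p.2 p.1).prodMk (hasDerivAt_id p.2))
  refine Prod.ext (hx.deriv.trans ?_) (hy.deriv.trans ?_) <;> simp [functionalOf]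

lemma contDiff_one_uu (hk : 1 ≤ k) (hC : 1 ≤ C) : ContDiff ℝ 1 (uu k C) := by
  refine contDiff_one_iff_fderiv.2 ⟨fun p => (hasFDerivAt_uu hk hC p).differentiableAt, ?_⟩
  rw [show fderiv ℝ (uu k C) = fun p => functionalOf (gradFormula k C p) from
    funext fun p => (hasFDerivAt_uu hk hC p).fderiv]
  have := continuous_gradCore hk hC
  exact (((continuous_const.mul this.fst).add continuous_const).smul continuous_const).add
    ((continuous_const.mul this.snd).smul continuous_const)

lemma contDiffOn_two_uu (hC : 0 < C) : ContDiffOn ℝ 2 (uu k C) {x : ℝ × ℝ | x ≠ 0} := by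
  have hb : ContDiffOn ℝ 2 (fun p : ℝ × ℝ => potBase k C p.1 p.2) {x : ℝ × ℝ | x ≠ 0} := by
    unfold potBase; fun_prop
  exact (contDiffOn_const.mul (hb.rpow_const_of_ne fun p hp => (potBase_pos hC hp).ne')).add
    (contDiffOn_const.mul contDiffOn_fst)

end Derivative

/-- u is C¹ on ℝ², its gradient is (1 - 1/(2k))-Hölder on every bounded set, u is C² away
from the origin, and ∇u(0,0) = (2,0). -/
theorem u_regularity (k : ℕ) (hk : 1 ≤ k) (C : ℝ)
    (hC : 2 * (k:ℝ) * (4 * (k:ℝ) + 1) < C) :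
    ContDiff ℝ 1 (uu k C) ∧
    (∀ s : Set (ℝ × ℝ), Bornology.IsBounded s → ∃ K : ℝ, ∀ x ∈ s, ∀ y ∈ s,
      ‖gradU k C x - gradU k C y‖ ≤ K * ‖x - y‖ ^ (1 - 1 / (2 * (k:ℝ)))) ∧
    ContDiffOn ℝ 2 (uu k C) {x : ℝ × ℝ | x ≠ 0} ∧
    gradU k C (0, 0) = (2, 0) := by
  have hk1 : (1 : ℝ) ≤ k := by exact_mod_cast hk
  have hC1 : 1 ≤ C := by nlinarith
  refine ⟨contDiff_one_uu hk hC1, fun s hs => ?_, contDiffOn_two_uu (by linarith), ?_⟩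
  · obtain ⟨R, hR⟩ := hs.exists_norm_le
    obtain ⟨K, hK⟩ := exists_holder_gradCore hk hC1 R
    set M := max |4 * (k : ℝ) - 1| |2 * C * (1 - 1 / (4 * (k : ℝ)))| with hM
    refine ⟨M * K, fun x hx y hy => ?_⟩
    rw [gradU_eq_s8 hk hC1, gradU_eq_s8 hk hC1, mul_assoc]
    refine le_trans ?_ (mul_le_mul_of_nonneg_left (hK x y (hR x hx) (hR y hy))
      ((abs_nonneg _).trans (le_max_left _ _)))
    rw [Prod.norm_def, max_le_iff]
    constructor
    · simp only [gradFormula, Prod.fst_sub, add_sub_add_right_eq_sub, ← mul_sub, norm_mul]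
      exact mul_le_mul (le_max_left _ _) (norm_fst_le (gradCore k C x - gradCore k C y))
        (norm_nonneg _) ((abs_nonneg _).trans (le_max_left _ _))
    · simp only [gradFormula, Prod.snd_sub, ← mul_sub]
      rw [norm_mul]
      exact mul_le_mul (le_max_right _ _) (norm_snd_le (gradCore k C x - gradCore k C y))
        (norm_nonneg _) ((abs_nonneg _).trans (le_max_left _ _))
  · have h0 : gradCore k C (0, 0) = 0 := gradCore_zero hk
    rw [gradU_eq_s8 hk hC1, gradFormula, h0]
    simp
end
end

section
/- For every x₁ ∈ (0,1), at the point x = (x₁, x₁^{2k}) one has ∂u/∂x₁(x) > 0 and ∂u/∂x₂(x) > (C/(4k+1)) x₁^{2k−1} ∂u/∂x₁(x); consequently, since C > 2k(4k+1), ∂u/∂x₂(x) > 2k x₁^{2k−1} ∂u/∂x₁(x). -/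
noncomputable section

/-- On the curve `y = x ^ (2 * k)` the power occurring in both partial derivatives of `uu`
factors as a constant times `x⁻¹`. -/
theorem rpow_on_boundary_curve {k : ℕ} (hk : 1 ≤ k) {C x : ℝ} (hC : 0 < C) (hx : 0 < x) :
    (x ^ (4 * k) / C + (x ^ (2 * k)) ^ 2) ^ (-(1 / (4 * (k:ℝ)))) =
      (1 + 1 / C) ^ (-(1 / (4 * (k:ℝ)))) * x⁻¹ := by
  have hk0 : (k:ℝ) ≠ 0 := by positivity
  have hbase : x ^ (4 * k) / C + (x ^ (2 * k)) ^ 2 = (1 + 1 / C) * x ^ (4 * k) := by ring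
  rw [hbase, Real.mul_rpow (by positivity) (by positivity), ← Real.rpow_natCast x (4 * k),
    ← Real.rpow_mul hx.le, ← Real.rpow_neg_one x]
  congr 2
  push_cast
  field_simp

theorem hasDerivAt_uu_fst {k : ℕ} {C x y : ℝ} (hP : x ^ (4 * k) / C + y ^ 2 ≠ 0) :
    HasDerivAt (fun s => uu k C (s, y))
      (C * (((4 * k : ℕ) : ℝ) * x ^ (4 * k - 1) / C * (1 - 1 / (4 * (k:ℝ))) *
        (x ^ (4 * k) / C + y ^ 2) ^ (-(1 / (4 * (k:ℝ))))) + 2) x := by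
  have h := ((((hasDerivAt_pow (4 * k) x).div_const C).add_const (y ^ 2)).rpow_const
    (p := 1 - 1 / (4 * (k:ℝ))) (Or.inl hP)).const_mul C |>.add ((hasDerivAt_id x).const_mul 2)
  have he : (1:ℝ) - 1 / (4 * (k:ℝ)) - 1 = -(1 / (4 * (k:ℝ))) := by ring
  rw [he, mul_one] at h
  exact h

theorem hasDerivAt_uu_snd {k : ℕ} {C x y : ℝ} (hP : x ^ (4 * k) / C + y ^ 2 ≠ 0) :
    HasDerivAt (fun s => uu k C (x, s))
      (C * (2 * y * (1 - 1 / (4 * (k:ℝ))) *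
        (x ^ (4 * k) / C + y ^ 2) ^ (-(1 / (4 * (k:ℝ)))))) y := by
  have h := ((((hasDerivAt_pow 2 y).const_add (x ^ (4 * k) / C)).rpow_const
    (p := 1 - 1 / (4 * (k:ℝ))) (Or.inl hP)).const_mul C).add_const (2 * x)
  have he : (1:ℝ) - 1 / (4 * (k:ℝ)) - 1 = -(1 / (4 * (k:ℝ))) := by ring
  simp only [he, Nat.cast_ofNat, Nat.add_one_sub_one, pow_one] at h
  exact h

theorem half_le_rpow {k : ℕ} (hk : 1 ≤ k) {C : ℝ} (hC : 1 ≤ C) :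
    1 / 2 ≤ (1 + 1 / C) ^ (-(1 / (4 * (k:ℝ)))) := by
  have hk1 : (1:ℝ) ≤ k := by exact_mod_cast hk
  have hC0 : 0 < C := by linarith
  have hC1 : 1 / C ≤ 1 := by rwa [div_le_one hC0]
  have hexp : 1 / (4 * (k:ℝ)) ≤ 1 := by
    rw [div_le_one (by positivity)]
    linarith
  calc (1:ℝ) / 2 ≤ (1 + 1 / C)⁻¹ := by
        rw [one_div]
        exact inv_anti₀ (by positivity) (by linarith)
    _ = (1 + 1 / C) ^ (-1 : ℝ) := (Real.rpow_neg_one _).symm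
    _ ≤ (1 + 1 / C) ^ (-(1 / (4 * (k:ℝ)))) :=
        Real.rpow_le_rpow_of_exponent_le (by linarith [one_div_pos.mpr hC0]) (by linarith)

/-- At points x = (x₁, x₁^{2k}) with x₁ ∈ (0,1): ∂₁u(x) > 0,
∂₂u(x) > (C/(4k+1)) x₁^{2k-1} ∂₁u(x), and consequently (as C > 2k(4k+1))
∂₂u(x) > 2k x₁^{2k-1} ∂₁u(x). -/
theorem partials_on_boundary_curve (k : ℕ) (hk : 1 ≤ k) (C : ℝ)
    (hC : 2 * (k:ℝ) * (4 * (k:ℝ) + 1) < C)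
    (x₁ : ℝ) (hx₁ : x₁ ∈ Set.Ioo (0:ℝ) 1) :
    0 < deriv (fun s => uu k C (s, x₁ ^ (2 * k))) x₁ ∧
    C / (4 * (k:ℝ) + 1) * x₁ ^ (2 * k - 1) * deriv (fun s => uu k C (s, x₁ ^ (2 * k))) x₁
      < deriv (fun s => uu k C (x₁, s)) (x₁ ^ (2 * k)) ∧
    2 * (k:ℝ) * x₁ ^ (2 * k - 1) * deriv (fun s => uu k C (s, x₁ ^ (2 * k))) x₁
      < deriv (fun s => uu k C (x₁, s)) (x₁ ^ (2 * k)) := by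
  obtain ⟨hx0, hxlt⟩ := hx₁
  have hk1 : (1:ℝ) ≤ k := by exact_mod_cast hk
  have hC1 : 1 ≤ C := by nlinarith
  have hC0 : 0 < C := by linarith
  have hP : x₁ ^ (4 * k) / C + (x₁ ^ (2 * k)) ^ 2 ≠ 0 := by positivity
  rw [(hasDerivAt_uu_fst hP).deriv, (hasDerivAt_uu_snd hP).deriv,
    rpow_on_boundary_curve hk hC0 hx0]
  have hq := half_le_rpow hk hC1
  set q := (1 + 1 / C) ^ (-(1 / (4 * (k:ℝ))))
  have hfst : C * (((4 * k : ℕ) : ℝ) * x₁ ^ (4 * k - 1) / C * (1 - 1 / (4 * (k:ℝ))) *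
      (q * x₁⁻¹)) + 2 = (4 * k - 1) * q * x₁ ^ (4 * k - 2) + 2 := by
    rw [show 4 * k - 1 = 4 * k - 2 + 1 by lia, pow_succ]
    push_cast
    field_simp
  have hsnd : C * (2 * x₁ ^ (2 * k) * (1 - 1 / (4 * (k:ℝ))) * (q * x₁⁻¹)) =
      C * (2 * (4 * k - 1) / (4 * k) * q) * x₁ ^ (2 * k - 1) := by
    rw [show x₁ ^ (2 * k) = x₁ ^ (2 * k - 1) * x₁ by rw [← pow_succ]; congr 1; lia]
    field_simp
  rw [hfst, hsnd]
  have ht0 : 0 < x₁ ^ (2 * k - 1) := by positivity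
  have hr0 : 0 < x₁ ^ (4 * k - 2) := by positivity
  have hr1 : x₁ ^ (4 * k - 2) < 1 := pow_lt_one₀ hx0.le hxlt (by lia)
  set t := x₁ ^ (2 * k - 1)
  set r := x₁ ^ (4 * k - 2)
  have ha : 0 < (4 * (k:ℝ) - 1) * q := mul_pos (by linarith) (by linarith)
  have hpos : 0 < (4 * k - 1) * q * r + 2 := by positivity
  have hmain : ((4 * k - 1) * q * r + 2) / (4 * (k:ℝ) + 1) < 2 * (4 * k - 1) / (4 * k) * q := by
    rw [div_mul_eq_mul_div, div_lt_div_iff₀ (by positivity) (by positivity)]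
    have hr : (4 * k - 1) * q * r < (4 * k - 1) * q := mul_lt_of_lt_one_right ha hr1
    have hqk : (4 * k - 1) * (4 * k + 2) * (1 / 2) ≤ (4 * k - 1) * (4 * (k:ℝ) + 2) * q :=
      mul_le_mul_of_nonneg_left hq (mul_nonneg (by linarith) (by linarith))
    nlinarith
  have hsecond : C / (4 * (k:ℝ) + 1) * t * ((4 * k - 1) * q * r + 2) <
      C * (2 * (4 * k - 1) / (4 * k) * q) * t := by
    calc C / (4 * (k:ℝ) + 1) * t * ((4 * k - 1) * q * r + 2)
        = C * (((4 * k - 1) * q * r + 2) / (4 * (k:ℝ) + 1)) * t := by ring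
      _ < C * (2 * (4 * k - 1) / (4 * k) * q) * t := by gcongr
  refine ⟨hpos, hsecond, lt_trans ?_ hsecond⟩
  have hcoef : 2 * (k:ℝ) < C / (4 * (k:ℝ) + 1) := by rwa [lt_div_iff₀ (by positivity)]
  gcongr
end
end

section
/- Let γ : [0,1] → ℝ² be a C^∞ curve such that min_{t∈[0,1]} |γ'(t)| > 0 and γ(t₁) ≠ γ(t₂) whenever t₁ ≠ t₂, and suppose there exist r ∈ (0, 1/2) and u₀, u₁ ∈ C^∞(ℝ²) with γ'(t) = ∇u₀(γ(t)) for t ∈ [0,r] and γ'(t) = ∇u₁(γ(t)) for t ∈ [1−r, 1]. Then there exist δ > 0, an open set U ⊂ ℝ² containing γ([0,1]) and containing the balls B_δ(γ(0)) and B_δ(γ(1)), and a C^∞ function u : U → ℝ such that inf_U |∇u| > 0, ∇u = ∇u₀ on B_δ(γ(0)), ∇u = ∇u₁ on B_δ(γ(1)), and γ'(t) = ∇u(γ(t)) for all t ∈ [0,1]. -/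
open Set Filter Metric
open scoped Topology ContDiff RealInnerProductSpace

theorem eventually_forall_mem_of_injOn {X Y : Type*} [TopologicalSpace X] [TopologicalSpace Y]
    [T2Space Y] {f : X → Y} {K : Set X} (hK : IsCompact K) (hf : ContinuousOn f K)
    (hinj : InjOn f K) {t : X} (ht : t ∈ K) {N : Set X} (hN : N ∈ 𝓝 t) :
    ∀ᶠ y in 𝓝 (f t), ∀ s ∈ K, f s = y → s ∈ N := by
  have hcpt : IsCompact (f '' (K \ interior N)) :=
    (hK.diff isOpen_interior).image_of_continuousOn (hf.mono sdiff_subset)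
  have hmem : f t ∉ f '' (K \ interior N) := by
    rintro ⟨s, ⟨hs, hsN⟩, hst⟩
    exact hsN (hinj hs ht hst ▸ mem_interior_iff_mem_nhds.2 hN)
  filter_upwards [hcpt.isClosed.isOpen_compl.mem_nhds hmem] with y hy s hs hsy
  by_contra hsN
  exact hy ⟨s, ⟨hs, fun h => hsN (interior_subset h)⟩, hsy⟩

section InnerProductSpace

variable {E : Type*} [NormedAddCommGroup E] [InnerProductSpace ℝ E]

/-- A smooth curve has, near a point of nonzero velocity, a smooth left inverse defined on an open
subset of the ambient space. -/
theorem exists_local_leftInverse_curve {γ : ℝ → E} {S : Set ℝ} (hS : IsOpen S)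
    (hγ : ContDiffOn ℝ ∞ γ S) {t : ℝ} (ht : t ∈ S) (h0 : deriv γ t ≠ 0) :
    ∃ W : Set E, IsOpen W ∧ γ t ∈ W ∧ ∃ σ : E → ℝ, ContDiffOn ℝ ∞ σ W ∧
      ∀ᶠ s in 𝓝 t, σ (γ s) = s := by
  set f : ℝ → ℝ := fun s => ⟪γ s, deriv γ t⟫ with hf_def
  have hf : ContDiffOn ℝ ∞ f S := hγ.inner ℝ contDiffOn_const
  have hfAt : ∀ s ∈ S, ContDiffAt ℝ ∞ f s := fun s hs => hf.contDiffAt (hS.mem_nhds hs)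
  have hderiv : ∀ s ∈ S, HasDerivAt f (deriv f s) s := fun s hs =>
    ((hfAt s hs).differentiableAt (by simp)).hasDerivAt
  have hft : deriv f t ≠ 0 := by
    have h1 : HasDerivAt γ (deriv γ t) t :=
      ((hγ.contDiffAt (hS.mem_nhds ht)).differentiableAt (by simp)).hasDerivAt
    have h2 := (h1.inner ℝ (hasDerivAt_const t (deriv γ t))).deriv
    rw [hf_def, h2]
    simpa using h0
  have hS' : IsOpen (S ∩ deriv f ⁻¹' {0}ᶜ) :=
    (hf.continuousOn_deriv_of_isOpen hS (by simp)).isOpen_inter_preimage hS isOpen_compl_singleton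
  have hfd : HasFDerivAt f
      ((ContinuousLinearEquiv.unitsEquivAut ℝ (Units.mk0 _ hft) : ℝ ≃L[ℝ] ℝ) : ℝ →L[ℝ] ℝ) t :=
    (hderiv t ht).hasFDerivAt_equiv hft
  set e := (hfAt t ht).toOpenPartialHomeomorph f hfd (by simp) with he
  have het : t ∈ e.source := (hfAt t ht).mem_toOpenPartialHomeomorph_source hfd (by simp)
  have hcoe : ∀ s, e s = f s := fun s => by
    rw [he, ContDiffAt.toOpenPartialHomeomorph_coe]
  refine ⟨(fun x => ⟪x, deriv γ t⟫) ⁻¹' (e.target ∩ e.symm ⁻¹' (S ∩ deriv f ⁻¹' {0}ᶜ)),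
    (e.isOpen_inter_preimage_symm hS').preimage (by fun_prop), ?_,
    fun x => e.symm ⟪x, deriv γ t⟫, ?_, ?_⟩
  · rw [mem_preimage]
    change f t ∈ _
    rw [← hcoe]
    refine ⟨e.map_source het, ?_⟩
    rw [mem_preimage, e.left_inv het]
    exact ⟨ht, hft⟩
  · rintro x ⟨hx1, hx2, hx3⟩
    refine ContDiffAt.contDiffWithinAt ?_
    refine ContDiffAt.comp x (g := e.symm) ?_ (contDiffAt_id.inner ℝ contDiffAt_const)
    exact e.contDiffAt_symm_deriv hx3 hx1 (hderiv _ hx2) (hfAt _ hx2)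
  · filter_upwards [e.open_source.mem_nhds het] with s hs
    change e.symm (f s) = s
    rw [← hcoe, e.left_inv hs]

/-- An injective regular curve has a smooth left inverse defined on the whole ambient space. -/
theorem exists_leftInverse_curve [FiniteDimensional ℝ E] {γ : ℝ → E} {S K : Set ℝ}
    (hS : IsOpen S) (hγ : ContDiffOn ℝ ∞ γ S) (hK : IsCompact K) (hKS : K ⊆ S)
    (h0 : ∀ t ∈ K, deriv γ t ≠ 0) (hinj : InjOn γ K) :
    ∃ σ : E → ℝ, ContDiff ℝ ∞ σ ∧ ∀ s ∈ K, σ (γ s) = s := by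
  have hcont : ContinuousOn γ K := hγ.continuousOn.mono hKS
  have hclosed : IsClosed (γ '' K) := (hK.image_of_continuousOn hcont).isClosed
  obtain ⟨σ, hσ⟩ := exists_contMDiffMap_forall_mem_convex_of_local (n := (⊤ : ℕ∞))
    (modelWithCornersSelf ℝ E) (t := fun x : E => {y : ℝ | ∀ s ∈ K, γ s = x → y = s})
    (fun x y hy z hz a b _ _ hab s hs hsx => by
      simp only [hy s hs hsx, hz s hs hsx, smul_eq_mul, ← add_mul, hab, one_mul])
    (fun x => by
      by_cases hx : x ∈ γ '' K
      · obtain ⟨t, ht, rfl⟩ := hx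
        obtain ⟨W, hW, htW, σ, hσ, hev⟩ := exists_local_leftInverse_curve hS hγ (hKS ht) (h0 t ht)
        refine ⟨_, inter_mem (hW.mem_nhds htW)
          (eventually_forall_mem_of_injOn hK hcont hinj ht hev), σ,
          (hσ.mono inter_subset_left).contMDiffOn, ?_⟩
        rintro _ ⟨-, hy⟩ s hs rfl
        exact hy s hs rfl
      · refine ⟨_, hclosed.isOpen_compl.mem_nhds hx, 0, contMDiffOn_const, ?_⟩
        exact fun y hy s hs hsy => (hy ⟨s, hs, hsy⟩).elim)
  exact ⟨σ, σ.contMDiff.contDiff, fun s hs => hσ _ s hs rfl⟩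

variable [CompleteSpace E]

/-- A function whose gradient along the curve is its velocity, built from a left inverse of the
curve and an antiderivative of the squared speed. -/
theorem hasGradientAt_curve_extension {γ γ' : ℝ → E} {h : ℝ → ℝ} {σ : E → ℝ} {s : ℝ}
    (hσ : DifferentiableAt ℝ σ (γ s)) (hσs : σ (γ s) = s) (hγ : HasDerivAt γ (γ' s) s)
    (hγ' : DifferentiableAt ℝ γ' s) (hh : HasDerivAt h (‖γ' s‖ ^ 2) s) :
    HasGradientAt (fun x => h (σ x) + ⟪x - γ (σ x), γ' (σ x)⟫) (γ' s) (γ s) := by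
  rw [hasGradientAt_iff_hasFDerivAt]
  have hσ' := hσ.hasFDerivAt
  have h1 : HasFDerivAt (fun x => h (σ x)) _ (γ s) :=
    HasDerivAt.comp_hasFDerivAt (h₂ := h) (γ s) (by rwa [hσs]) hσ'
  have h2 : HasFDerivAt (fun x => γ (σ x)) _ (γ s) :=
    HasFDerivAt.comp (g := γ) (γ s) (by rw [hσs]; exact hγ.hasFDerivAt) hσ'
  have h3 : HasFDerivAt (fun x => γ' (σ x)) _ (γ s) :=
    HasFDerivAt.comp (g := γ') (γ s) (by rw [hσs]; exact hγ'.hasFDerivAt) hσ'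
  refine (h1.add (((hasFDerivAt_id (γ s)).sub h2).inner ℝ h3)).congr_fderiv ?_
  ext w
  simp [hσs, inner_sub_left, inner_smul_left, real_inner_comm w]
  ring

/-- Two functions can be glued along a ball, keeping the gradient at all points where their first
order data agree. -/
theorem exists_glue_ball [FiniteDimensional ℝ E] {p : E} {R : ℝ} (hR : 0 < R) {V : Set E}
    (hV : IsOpen V) {v a : E → ℝ} (hv : ContDiffOn ℝ ∞ v V) (ha : ContDiff ℝ ∞ a) :
    ∃ w : E → ℝ, ContDiffOn ℝ ∞ w (V ∪ ball p (R / 2)) ∧ EqOn w a (ball p (R / 2)) ∧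
      EqOn w v (ball p R)ᶜ ∧
      ∀ x, ∀ g : E, HasGradientAt v g x →
        (x ∈ ball p R → a x = v x ∧ HasGradientAt a g x) → w x = v x ∧ HasGradientAt w g x := by
  let χ : ContDiffBump p := ⟨R / 2, 3 * R / 4, by positivity, by linarith⟩
  have hχ : ContDiff ℝ ∞ χ := χ.contDiff
  set w : E → ℝ := fun x => v x + χ x * (a x - v x) with hw
  have hin : EqOn w a (ball p (R / 2)) := fun x hx => by
    simp [hw, χ.one_of_mem_closedBall (ball_subset_closedBall hx)]
  have hout : EqOn w v (closedBall p (3 * R / 4))ᶜ := fun x hx => by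
    have : χ x = 0 := χ.zero_of_le_dist (by simpa using (not_le.1 (mem_closedBall.not.1 hx)).le)
    simp [hw, this]
  have hsub : (ball p R)ᶜ ⊆ (closedBall p (3 * R / 4))ᶜ :=
    compl_subset_compl.2 (closedBall_subset_ball (by linarith))
  refine ⟨w, ?_, hin, hout.mono hsub, ?_⟩
  · rintro x (hx | hx)
    · have hvx := hv.contDiffAt (hV.mem_nhds hx)
      exact (hvx.add (hχ.contDiffAt.mul (ha.contDiffAt.sub hvx))).contDiffWithinAt
    · exact (ha.contDiffAt.congr_of_eventuallyEq
        (hin.eventuallyEq_of_mem (isOpen_ball.mem_nhds hx))).contDiffWithinAt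
  · intro x g hg hag
    by_cases hx : x ∈ ball p R
    · obtain ⟨hax, hga⟩ := hag hx
      refine ⟨by simp [hw, hax], ?_⟩
      rw [hasGradientAt_iff_hasFDerivAt] at *
      have hχx := (hχ.differentiable (by simp) x).hasFDerivAt
      refine (hg.add (hχx.mul (hga.sub hg))).congr_fderiv ?_
      simp [hax]
    · refine ⟨hout (hsub hx), hg.congr_of_eventuallyEq
        (hout.eventuallyEq_of_mem (isClosed_closedBall.isOpen_compl.mem_nhds (hsub hx)))⟩

theorem HasGradientAt.sub_const' {f : E → ℝ} {g x : E} (hf : HasGradientAt f g x) (c : ℝ) :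
    HasGradientAt (fun y => f y - c) g x := by
  rw [hasGradientAt_iff_hasFDerivAt] at *
  exact hf.sub_const c

/-- Along a gradient flow, a potential grows at the rate of the squared speed. -/
theorem exists_sub_const_of_gradient_flow {γ γ' : ℝ → E} {h : ℝ → ℝ} {u : E → ℝ} {a b : ℝ}
    (hu : Differentiable ℝ u)
    (hγ : ∀ s ∈ Ioo a b, HasDerivAt γ (γ' s) s)
    (hh : ∀ s ∈ Ioo a b, HasDerivAt h (‖γ' s‖ ^ 2) s)
    (hflow : ∀ s ∈ Ioo a b, γ' s = gradient u (γ s)) :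
    ∃ c, ∀ s ∈ Ioo a b, u (γ s) - c = h s := by
  have hd : ∀ s ∈ Ioo a b, HasDerivAt (fun s => u (γ s) - h s) 0 s := fun s hs => by
    have h1 := ((hu (γ s)).hasGradientAt.hasFDerivAt.comp_hasDerivAt s (hγ s hs)).sub (hh s hs)
    refine h1.congr_deriv ?_
    simp [← hflow s hs]
  obtain ⟨c, hc⟩ := isOpen_Ioo.exists_is_const_of_deriv_eq_zero isPreconnected_Ioo
    (fun s hs => (hd s hs).differentiableAt.differentiableWithinAt)
    (fun s hs => (hd s hs).deriv)
  exact ⟨c, fun s hs => by linarith [hc s hs]⟩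

end InnerProductSpace

theorem exists_hasDerivAt_Ioo {f : ℝ → ℝ} {a b : ℝ} (hf : ContinuousOn f (Ioo a b)) :
    ∃ F : ℝ → ℝ, ∀ x ∈ Ioo a b, HasDerivAt F (f x) x := by
  refine ⟨fun x => ∫ t in ((a + b) / 2)..x, f t, fun x hx => ?_⟩
  have hm : (a + b) / 2 ∈ Ioo a b := by
    constructor <;> linarith [hx.1, hx.2]
  refine intervalIntegral.integral_hasDerivAt_right ?_
    (hf.stronglyMeasurableAtFilter isOpen_Ioo x hx) (hf.continuousAt (isOpen_Ioo.mem_nhds hx))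
  exact (hf.mono (ordConnected_Ioo.uIcc_subset hm hx)).intervalIntegrable

/-- The Euclidean plane ℝ². -/
abbrev E2 := EuclideanSpace ℝ (Fin 2)

/-- Appendix Lemma A.1: a smooth, injective, nondegenerate curve γ : [0,1] → ℝ² which near
its endpoints is a gradient flow of smooth functions u₀ and u₁ is globally a gradient flow
of a smooth function u, defined on a neighborhood U of the curve, with nonvanishing
gradient, and with ∇u = ∇u₀ near γ(0) and ∇u = ∇u₁ near γ(1). -/
theorem gradient_flow_extension (γ : ℝ → E2)
    (hγ_smooth : ContDiffOn ℝ (⊤ : ℕ∞) γ (Set.Icc 0 1))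
    (hγ_speed : ∃ c > 0, ∀ t ∈ Set.Icc (0:ℝ) 1, c ≤ ‖derivWithin γ (Set.Icc 0 1) t‖)
    (hγ_inj : Set.InjOn γ (Set.Icc 0 1))
    (r : ℝ) (hr : r ∈ Set.Ioo (0:ℝ) (1/2))
    (u₀ u₁ : E2 → ℝ) (hu₀ : ContDiff ℝ (⊤ : ℕ∞) u₀) (hu₁ : ContDiff ℝ (⊤ : ℕ∞) u₁)
    (hflow₀ : ∀ t ∈ Set.Icc (0:ℝ) r, derivWithin γ (Set.Icc 0 1) t = gradient u₀ (γ t))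
    (hflow₁ : ∀ t ∈ Set.Icc (1 - r) (1:ℝ),
      derivWithin γ (Set.Icc 0 1) t = gradient u₁ (γ t)) :
    ∃ (δ : ℝ) (U : Set E2) (u : E2 → ℝ), 0 < δ ∧ IsOpen U ∧
      γ '' Set.Icc 0 1 ⊆ U ∧
      Metric.ball (γ 0) δ ⊆ U ∧ Metric.ball (γ 1) δ ⊆ U ∧
      ContDiffOn ℝ (⊤ : ℕ∞) u U ∧
      (∃ c > 0, ∀ x ∈ U, c ≤ ‖gradient u x‖) ∧
      (∀ x ∈ Metric.ball (γ 0) δ, gradient u x = gradient u₀ x) ∧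
      (∀ x ∈ Metric.ball (γ 1) δ, gradient u x = gradient u₁ x) ∧
      (∀ t ∈ Set.Icc (0:ℝ) 1, derivWithin γ (Set.Icc 0 1) t = gradient u (γ t)) := by
  obtain ⟨hr0, hr2⟩ := hr
  obtain ⟨c, hc0, hc⟩ := hγ_speed
  set γ' : ℝ → E2 := derivWithin γ (Icc 0 1) with hγ'_def
  have h0I : (0 : ℝ) ∈ Icc (0 : ℝ) 1 := by simp
  have h1I : (1 : ℝ) ∈ Icc (0 : ℝ) 1 := by simp
  have hγ' : ∀ s ∈ Ioo (0 : ℝ) 1, HasDerivAt γ (γ' s) s := fun s hs =>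
    ((hγ_smooth.differentiableOn (by simp) s (Ioo_subset_Icc_self hs)).hasDerivWithinAt).hasDerivAt
      (Icc_mem_nhds hs.1 hs.2)
  have hγ'_smooth : ContDiffOn ℝ ∞ γ' (Ioo 0 1) :=
    (hγ_smooth.derivWithin (uniqueDiffOn_Icc one_pos) (by simp)).mono Ioo_subset_Icc_self
  obtain ⟨h, hh⟩ := exists_hasDerivAt_Ioo (a := 0) (b := 1) (f := fun s => ‖γ' s‖ ^ 2)
    (hγ'_smooth.continuousOn.norm.pow 2)
  have hh_smooth : ContDiffOn ℝ ∞ h (Ioo 0 1) := by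
    refine (contDiffOn_infty_iff_deriv_of_isOpen isOpen_Ioo).2
      ⟨fun s hs => (hh s hs).differentiableAt.differentiableWithinAt, ?_⟩
    exact (hγ'_smooth.norm_sq ℝ).congr fun s hs => (hh s hs).deriv
  have hsub₀ : Ioo 0 r ⊆ Ioo (0 : ℝ) 1 := Ioo_subset_Ioo_right (by linarith)
  have hsub₁ : Ioo (1 - r) 1 ⊆ Ioo (0 : ℝ) 1 := Ioo_subset_Ioo_left (by linarith)
  obtain ⟨c₀, hc₀⟩ := exists_sub_const_of_gradient_flow (hu₀.differentiable (by simp))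
    (fun s hs => hγ' s (hsub₀ hs)) (fun s hs => hh s (hsub₀ hs))
    (fun s hs => hflow₀ s (Ioo_subset_Icc_self hs))
  obtain ⟨c₁, hc₁⟩ := exists_sub_const_of_gradient_flow (hu₁.differentiable (by simp))
    (fun s hs => hγ' s (hsub₁ hs)) (fun s hs => hh s (hsub₁ hs))
    (fun s hs => hflow₁ s (Ioo_subset_Icc_self hs))
  -- a ball around each endpoint which the curve meets only for nearby parameters
  have hγc := hγ_smooth.continuousOn
  obtain ⟨R, hR, hball₀, hball₁, hdist⟩ : ∃ R > 0,
      (∀ s ∈ Icc (0 : ℝ) 1, γ s ∈ ball (γ 0) R → s < r) ∧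
      (∀ s ∈ Icc (0 : ℝ) 1, γ s ∈ ball (γ 1) R → 1 - r < s) ∧ R + R ≤ dist (γ 0) (γ 1) := by
    obtain ⟨R₀, hR₀, h₀⟩ := Metric.eventually_nhds_iff_ball.1 <|
      eventually_forall_mem_of_injOn isCompact_Icc hγc hγ_inj h0I (Iio_mem_nhds hr0)
    obtain ⟨R₁, hR₁, h₁⟩ := Metric.eventually_nhds_iff_ball.1 <|
      eventually_forall_mem_of_injOn isCompact_Icc hγc hγ_inj h1I
        (Ioi_mem_nhds (show 1 - r < 1 by linarith))
    have hd : 0 < dist (γ 0) (γ 1) := dist_pos.2 fun h => zero_ne_one (hγ_inj h0I h1I h)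
    refine ⟨min (min R₀ R₁) (dist (γ 0) (γ 1) / 2), by positivity, ?_, ?_, ?_⟩
    · exact fun s hs hsb => h₀ _ (ball_subset_ball
        ((min_le_left _ _).trans (min_le_left _ _)) hsb) s hs rfl
    · exact fun s hs hsb => h₁ _ (ball_subset_ball
        ((min_le_left _ _).trans (min_le_right _ _)) hsb) s hs rfl
    · linarith [min_le_right (min R₀ R₁) (dist (γ 0) (γ 1) / 2)]
  have hR2 : 0 < R / 2 := by positivity
  have hballs : Disjoint (ball (γ 0) R) (ball (γ 1) R) := ball_disjoint_ball hdist
  have hshrink : ∀ p : E2, ball p (R / 2) ⊆ ball p R := fun p => ball_subset_ball (by linarith)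
  -- parameters whose images stay in the smaller balls
  obtain ⟨a, ha, hγa⟩ : ∃ a ∈ Ioo (0 : ℝ) r, ∀ s ∈ Ico 0 a, γ s ∈ ball (γ 0) (R / 2) := by
    have := (hγc 0 h0I).mono_left (nhdsWithin_mono 0 (Ico_subset_Icc_self))
    rw [nhdsWithin_Ico_eq_nhdsGE one_pos] at this
    obtain ⟨a, ha, hsub⟩ := (mem_nhdsGE_iff_exists_mem_Ioc_Ico_subset hr0).1
      (this (ball_mem_nhds _ hR2))
    refine ⟨a / 2, ⟨half_pos ha.1, by linarith [ha.1, ha.2]⟩, fun s hs => hsub ⟨hs.1, ?_⟩⟩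
    linarith [ha.1, hs.2]
  obtain ⟨b, hb, hγb⟩ : ∃ b ∈ Ioo (1 - r) (1 : ℝ), ∀ s ∈ Ioc b 1, γ s ∈ ball (γ 1) (R / 2) := by
    have := (hγc 1 h1I).mono_left (nhdsWithin_mono 1 (Ioc_subset_Icc_self))
    rw [nhdsWithin_Ioc_eq_nhdsLE one_pos] at this
    obtain ⟨b, hb, hsub⟩ := (mem_nhdsLE_iff_exists_mem_Ico_Ioc_subset
      (show 1 - r < 1 by linarith)).1 (this (ball_mem_nhds _ hR2))
    refine ⟨(b + 1) / 2, ⟨by linarith [hb.1, hb.2], by linarith [hb.2]⟩, fun s hs => hsub ⟨?_, hs.2⟩⟩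
    linarith [hb.2, hs.1]
  have hab : Icc a b ⊆ Ioo (0 : ℝ) 1 := fun s hs =>
    ⟨ha.1.trans_le hs.1, hs.2.trans_lt hb.2⟩
  obtain ⟨σ, hσ, hσγ⟩ := exists_leftInverse_curve (K := Icc a b) isOpen_Ioo
    (hγ_smooth.mono Ioo_subset_Icc_self) isCompact_Icc hab
    (fun t ht => by
      rw [(hγ' t (hab ht)).deriv, ← norm_pos_iff]
      exact hc0.trans_le (hc t (Ioo_subset_Icc_self (hab ht))))
    (hγ_inj.mono (hab.trans Ioo_subset_Icc_self))
  set v : E2 → ℝ := fun x => h (σ x) + inner ℝ (x - γ (σ x)) (γ' (σ x)) with hv_def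
  have hV : IsOpen (σ ⁻¹' Ioo 0 1) := isOpen_Ioo.preimage hσ.continuous
  have hv : ContDiffOn ℝ ∞ v (σ ⁻¹' Ioo 0 1) := by
    have hmaps : MapsTo σ (σ ⁻¹' Ioo 0 1) (Ioo 0 1) := fun x hx => hx
    have hγ_Ioo : ContDiffOn ℝ ∞ γ (Ioo 0 1) := hγ_smooth.mono Ioo_subset_Icc_self
    exact (hh_smooth.comp hσ.contDiffOn hmaps).add
      ((contDiffOn_id.sub (hγ_Ioo.comp hσ.contDiffOn hmaps)).inner ℝ
        (hγ'_smooth.comp hσ.contDiffOn hmaps))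
  have hu₀' : ContDiff ℝ ∞ fun x => u₀ x - c₀ := hu₀.sub contDiff_const
  have hu₁' : ContDiff ℝ ∞ fun x => u₁ x - c₁ := hu₁.sub contDiff_const
  have hgrad₀ : ∀ x, HasGradientAt (fun x => u₀ x - c₀) (gradient u₀ x) x := fun x =>
    (hu₀.differentiable (by simp) x).hasGradientAt.sub_const' c₀
  have hgrad₁ : ∀ x, HasGradientAt (fun x => u₁ x - c₁) (gradient u₁ x) x := fun x =>
    (hu₁.differentiable (by simp) x).hasGradientAt.sub_const' c₁
  obtain ⟨w, hw, hw_in, hw_out, hw_grad⟩ := exists_glue_ball (p := γ 0) hR hV hv hu₀'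
  have hV' := hV.union (isOpen_ball (x := γ 0) (ε := R / 2))
  obtain ⟨u, hu, hu_in, hu_out, hu_grad⟩ := exists_glue_ball (p := γ 1) hR hV' hw hu₁'
  have hu_in₀ : EqOn u (fun x => u₀ x - c₀) (ball (γ 0) (R / 2)) := fun x hx =>
    (hu_out (hballs.notMem_of_mem_left (hshrink _ hx))).trans (hw_in hx)
  have hgradu₀ : ∀ x ∈ ball (γ 0) (R / 2), gradient u x = gradient u₀ x := fun x hx =>
    ((hgrad₀ x).congr_of_eventuallyEq
      (hu_in₀.eventuallyEq_of_mem (isOpen_ball.mem_nhds hx))).gradient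
  have hgradu₁ : ∀ x ∈ ball (γ 1) (R / 2), gradient u x = gradient u₁ x := fun x hx =>
    ((hgrad₁ x).congr_of_eventuallyEq
      (hu_in.eventuallyEq_of_mem (isOpen_ball.mem_nhds hx))).gradient
  have hflow : ∀ t ∈ Icc (0 : ℝ) 1, γ' t = gradient u (γ t) := by
    intro t ht
    rcases lt_or_ge t a with hta | hta
    · rw [hgradu₀ _ (hγa t ⟨ht.1, hta⟩)]
      exact hflow₀ t ⟨ht.1, (hta.trans ha.2).le⟩
    rcases lt_or_ge b t with htb | htb
    · rw [hgradu₁ _ (hγb t ⟨htb, ht.2⟩)]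
      exact hflow₁ t ⟨(hb.1.trans htb).le, ht.2⟩
    have hσt := hσγ t ⟨hta, htb⟩
    have ht' := hab ⟨hta, htb⟩
    have hvt : v (γ t) = h t := by simp [hv_def, hσt]
    obtain ⟨hwt, hwg⟩ := hw_grad (γ t) (γ' t)
      (hasGradientAt_curve_extension (hσ.differentiable (by simp) _) hσt (hγ' t ht')
        ((hγ'_smooth.contDiffAt (isOpen_Ioo.mem_nhds ht')).differentiableAt (by simp)) (hh t ht'))
      (fun hmem => by
        have htr := hball₀ t ht hmem
        rw [hflow₀ t ⟨ht.1, htr.le⟩, hvt]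
        exact ⟨hc₀ t ⟨ht'.1, htr⟩, hgrad₀ _⟩)
    refine (hu_grad (γ t) (γ' t) hwg fun hmem => ?_).2.gradient.symm
    have htr := hball₁ t ht hmem
    rw [hflow₁ t ⟨htr.le, ht.2⟩, hwt, hvt]
    exact ⟨hc₁ t ⟨htr, ht'.2⟩, hgrad₁ _⟩
  set U₀ : Set E2 := σ ⁻¹' Ioo 0 1 ∪ ball (γ 0) (R / 2) ∪ ball (γ 1) (R / 2) with hU₀_def
  have hU₀ : IsOpen U₀ := hV'.union isOpen_ball
  have hcont : ContinuousOn (fun x => ‖gradient u x‖) U₀ := by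
    have := hu.continuousOn_fderiv_of_isOpen hU₀ (by simp)
    exact this.norm.congr fun x _ => by simp [gradient]
  have hU : IsOpen (U₀ ∩ (fun x => ‖gradient u x‖) ⁻¹' Ioi (c / 2)) :=
    hcont.isOpen_inter_preimage hU₀ isOpen_Ioi
  have hcurve : γ '' Icc 0 1 ⊆ U₀ ∩ (fun x => ‖gradient u x‖) ⁻¹' Ioi (c / 2) := by
    rintro _ ⟨t, ht, rfl⟩
    refine ⟨?_, ?_⟩
    · rcases lt_or_ge t a with hta | hta
      · exact Or.inl (Or.inr (hγa t ⟨ht.1, hta⟩))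
      rcases lt_or_ge b t with htb | htb
      · exact Or.inr (hγb t ⟨htb, ht.2⟩)
      · refine Or.inl (Or.inl ?_)
        rw [mem_preimage, hσγ t ⟨hta, htb⟩]
        exact hab ⟨hta, htb⟩
    · rw [mem_preimage, ← hflow t ht, mem_Ioi]
      linarith [hc t ht]
  obtain ⟨δ₀, hδ₀, hδ₀U⟩ := Metric.isOpen_iff.1 hU _ (hcurve ⟨0, h0I, rfl⟩)
  obtain ⟨δ₁, hδ₁, hδ₁U⟩ := Metric.isOpen_iff.1 hU _ (hcurve ⟨1, h1I, rfl⟩)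
  refine ⟨min (min δ₀ δ₁) (R / 2), _, u, by positivity, hU, hcurve, ?_, ?_,
    hu.mono inter_subset_left, ⟨c / 2, by positivity, fun x hx => hx.2.le⟩, ?_, ?_, hflow⟩
  · exact (ball_subset_ball ((min_le_left _ _).trans (min_le_left _ _))).trans hδ₀U
  · exact (ball_subset_ball ((min_le_left _ _).trans (min_le_right _ _))).trans hδ₁U
  · exact fun x hx => hgradu₀ x (ball_subset_ball (min_le_right _ _) hx)
  · exact fun x hx => hgradu₁ x (ball_subset_ball (min_le_right _ _) hx)
end

section
/- Let γ : [0,1] → ℝ² be a C^∞ curve with min_{t∈[0,1]} |γ'(t)| > 0, let U ⊂ ℝ² be an open set containing γ([0,1]), and let u ∈ C^∞(U) satisfy inf_U |∇u| > 0 and γ'(t) = ∇u(γ(t)) for all t ∈ [0,1]. Set M = u(γ(1)) − u(γ(0)) (so M > 0). Then for every r ∈ (−M, M) there exist u_r ∈ C^∞(U) and μ > 0 such that u_r(γ(0)) = u(γ(0)), u_r(γ(1)) = u(γ(0)) + r, |∇u_r(x)| ≤ |∇u(x)| for all x ∈ U, and ∇u_r = ∇u on (B_μ(γ(0)) ∪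 B_μ(γ(1))) ∩ U. -/
noncomputable section

open Set Filter Topology in
/-- A smooth `1`-Lipschitz reparametrisation of the line, with slope `1` near `a` and `b`, that
fixes `a` and sends `b` to `a + r`, where `|r| < b - a`. -/
theorem exists_smooth_reparam {a b r : ℝ} (hr : r ∈ Ioo (-(b - a)) (b - a)) :
    ∃ f : ℝ → ℝ, ContDiff ℝ (⊤ : ℕ∞) f ∧ f a = a ∧ f b = a + r ∧ (∀ x, |deriv f x| ≤ 1) ∧
      (∀ᶠ x in 𝓝 a, deriv f x = 1) ∧ ∀ᶠ x in 𝓝 b, deriv f x = 1 := by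
  obtain ⟨hr₁, hr₂⟩ := hr
  obtain ⟨ρ, hρ₁, hρ₂⟩ := exists_between (show (b - a - r) / 4 < (b - a) / 2 by linarith)
  obtain ⟨R, hR₁, hR₂⟩ := exists_between hρ₂
  let φ : ContDiffBump ((a + b) / 2) := ⟨ρ, R, by linarith, hR₁⟩
  have hφ_cont : Continuous φ := φ.continuous
  have hφ_zero : ∀ x, R < |x - (a + b) / 2| → φ x = 0 := fun x hx =>
    φ.zero_of_le_dist (by rw [Real.dist_eq]; exact hx.le)
  have hφ_int : 2 * ρ ≤ ∫ x in a..b, φ x := by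
    have hsub : ∫ x in ((a + b) / 2 - ρ)..((a + b) / 2 + ρ), φ x = 2 * ρ := by
      rw [intervalIntegral.integral_congr (g := fun _ => (1 : ℝ))]
      · simp; ring
      · intro x hx
        rw [uIcc_of_le (by linarith)] at hx
        apply φ.one_of_mem_closedBall
        rw [Metric.mem_closedBall, Real.dist_eq, abs_le]
        exact ⟨by linarith [hx.1], by linarith [hx.2]⟩
    rw [← hsub]
    exact intervalIntegral.integral_mono_interval (by linarith) (by linarith) (by linarith)
      (Eventually.of_forall fun x => φ.nonneg) (hφ_cont.intervalIntegrable _ _)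
  set I := ∫ x in a..b, φ x with hI
  have hI_pos : 0 < I := by linarith
  set c := (b - a - r) / I with hc
  have hcI : c * I = b - a - r := div_mul_cancel₀ _ hI_pos.ne'
  have hc₀ : 0 ≤ c := div_nonneg (by linarith) hI_pos.le
  have hc₂ : c ≤ 2 := (div_le_iff₀ hI_pos).2 (by linarith)
  have hderiv : ∀ x, HasDerivAt (fun y => y - c * ∫ t in a..y, φ t) (1 - c * φ x) x := fun x =>
    (hasDerivAt_id x).sub ((hφ_cont.integral_hasStrictDerivAt a x).hasDerivAt.const_mul c)
  have hderiv_eq : deriv (fun y => y - c * ∫ t in a..y, φ t) = fun x => 1 - c * φ x :=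
    funext fun x => (hderiv x).deriv
  refine ⟨fun y => y - c * ∫ t in a..y, φ t, ?_, by simp, ?_, ?_, ?_, ?_⟩
  · rw [contDiff_infty_iff_deriv, hderiv_eq]
    exact ⟨fun x => (hderiv x).differentiableAt,
      contDiff_const.sub (contDiff_const.mul φ.contDiff)⟩
  · linarith
  · intro x
    rw [hderiv_eq, abs_le]
    have h₀ : 0 ≤ φ x := φ.nonneg
    have h₁ : φ x ≤ 1 := φ.le_one
    constructor <;> nlinarith
  · have : ∀ᶠ x in 𝓝 a, R < |x - (a + b) / 2| := by
      refine (by fun_prop : Continuous fun x : ℝ => |x - (a + b) / 2|).continuousAt.eventually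
        (lt_mem_nhds ?_)
      rw [lt_abs]
      right; linarith
    filter_upwards [this] with x hx
    simp [hderiv_eq, hφ_zero x hx]
  · have : ∀ᶠ x in 𝓝 b, R < |x - (a + b) / 2| := by
      refine (by fun_prop : Continuous fun x : ℝ => |x - (a + b) / 2|).continuousAt.eventually
        (lt_mem_nhds ?_)
      rw [lt_abs]
      left; linarith
    filter_upwards [this] with x hx
    simp [hderiv_eq, hφ_zero x hx]

/-- The chain rule for the gradient of a function post-composed with a function of one variable. -/
theorem gradient_real_comp {F : Type*} [NormedAddCommGroup F] [InnerProductSpace ℝ F]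
    [CompleteSpace F] {f : ℝ → ℝ} {u : F → ℝ} {x : F} (hf : DifferentiableAt ℝ f (u x))
    (hu : DifferentiableAt ℝ u x) :
    gradient (f ∘ u) x = deriv f (u x) • gradient u x := by
  rw [gradient, (hf.hasDerivAt.comp_hasFDerivAt x hu.hasFDerivAt).fderiv, gradient]
  simp

/-- A differentiable function strictly increases along a gradient flow line on which its gradient
does not vanish. -/
theorem strictMonoOn_comp_of_gradient_flow {F : Type*} [NormedAddCommGroup F]
    [InnerProductSpace ℝ F] [CompleteSpace F] {u : F → ℝ} {γ : ℝ → F} {a b : ℝ}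
    (hγ : DifferentiableOn ℝ γ (Set.Icc a b))
    (hu : ∀ t ∈ Set.Icc a b, DifferentiableAt ℝ u (γ t))
    (hne : ∀ t ∈ Set.Icc a b, gradient u (γ t) ≠ 0)
    (hflow : ∀ t ∈ Set.Icc a b, derivWithin γ (Set.Icc a b) t = gradient u (γ t)) :
    StrictMonoOn (u ∘ γ) (Set.Icc a b) := by
  have hderiv : ∀ t ∈ Set.Icc a b,
      HasDerivWithinAt (u ∘ γ) (‖gradient u (γ t)‖ ^ 2) (Set.Icc a b) t := by
    intro t ht
    have h := (hu t ht).hasGradientAt.hasFDerivAt.comp_hasDerivWithinAt t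
      (hγ t ht).hasDerivWithinAt
    rwa [hflow t ht, InnerProductSpace.toDual_apply_apply, real_inner_self_eq_norm_sq] at h
  refine strictMonoOn_of_hasDerivWithinAt_pos (convex_Icc a b)
    (fun t ht => (hderiv t ht).continuousWithinAt)
    (fun t ht => (hderiv t (interior_subset ht)).mono interior_subset) fun t ht => ?_
  exact pow_pos (norm_pos_iff.2 (hne t (interior_subset ht))) 2

/-- Appendix Remark A.2: if γ : [0,1] → ℝ² is a gradient flow of u ∈ C^∞(U) with
nonvanishing gradient, and M = u(γ(1)) - u(γ(0)), then M > 0 and for every r ∈ (-M,M)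
there is u_r ∈ C^∞(U) with u_r(γ(0)) = u(γ(0)), u_r(γ(1)) = u(γ(0)) + r,
|∇u_r| ≤ |∇u| on U, and ∇u_r = ∇u near γ(0) and γ(1). -/
theorem potential_value_adjustment (γ : ℝ → E2)
    (hγ_smooth : ContDiffOn ℝ (⊤ : ℕ∞) γ (Set.Icc 0 1))
    (hγ_speed : ∃ c > 0, ∀ t ∈ Set.Icc (0:ℝ) 1, c ≤ ‖derivWithin γ (Set.Icc 0 1) t‖)
    (U : Set E2) (hU : IsOpen U) (hγU : γ '' Set.Icc 0 1 ⊆ U)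
    (u : E2 → ℝ) (hu : ContDiffOn ℝ (⊤ : ℕ∞) u U)
    (hgrad : ∃ c > 0, ∀ x ∈ U, c ≤ ‖gradient u x‖)
    (hflow : ∀ t ∈ Set.Icc (0:ℝ) 1, derivWithin γ (Set.Icc 0 1) t = gradient u (γ t)) :
    0 < u (γ 1) - u (γ 0) ∧
    ∀ r ∈ Set.Ioo (-(u (γ 1) - u (γ 0))) (u (γ 1) - u (γ 0)),
      ∃ (u_r : E2 → ℝ) (μ : ℝ), 0 < μ ∧
        ContDiffOn ℝ (⊤ : ℕ∞) u_r U ∧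
        u_r (γ 0) = u (γ 0) ∧
        u_r (γ 1) = u (γ 0) + r ∧
        (∀ x ∈ U, ‖gradient u_r x‖ ≤ ‖gradient u x‖) ∧
        (∀ x ∈ (Metric.ball (γ 0) μ ∪ Metric.ball (γ 1) μ) ∩ U,
          gradient u_r x = gradient u x) := by
  obtain ⟨c, hc, hcu⟩ := hgrad
  have hγ_mem : ∀ t ∈ Set.Icc (0 : ℝ) 1, γ t ∈ U := fun t ht => hγU ⟨t, ht, rfl⟩
  have hu_diff : ∀ x ∈ U, DifferentiableAt ℝ u x := fun x hx =>
    (hu.differentiableOn (by simp)).differentiableAt (hU.mem_nhds hx)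
  have hmono := strictMonoOn_comp_of_gradient_flow (hγ_smooth.differentiableOn (by simp))
    (fun t ht => hu_diff _ (hγ_mem t ht))
    (fun t ht => norm_pos_iff.1 (hc.trans_le (hcu _ (hγ_mem t ht)))) hflow
  have h0 : (0 : ℝ) ∈ Set.Icc (0 : ℝ) 1 := by simp
  have h1 : (1 : ℝ) ∈ Set.Icc (0 : ℝ) 1 := by simp
  refine ⟨sub_pos.2 (hmono h0 h1 zero_lt_one), fun r hr => ?_⟩
  obtain ⟨f, hf, hfa, hfb, hf_le, hf_a, hf_b⟩ := exists_smooth_reparam hr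
  have hgrad_comp : ∀ x ∈ U, gradient (f ∘ u) x = deriv f (u x) • gradient u x := fun x hx =>
    gradient_real_comp (hf.differentiable (by simp) _) (hu_diff x hx)
  obtain ⟨μ₀, hμ₀, hball₀⟩ := Metric.eventually_nhds_iff_ball.1
    ((hu_diff _ (hγ_mem 0 h0)).continuousAt.eventually hf_a)
  obtain ⟨μ₁, hμ₁, hball₁⟩ := Metric.eventually_nhds_iff_ball.1
    ((hu_diff _ (hγ_mem 1 h1)).continuousAt.eventually hf_b)
  refine ⟨f ∘ u, min μ₀ μ₁, lt_min hμ₀ hμ₁, hf.comp_contDiffOn hu, hfa, hfb, fun x hx => ?_, ?_⟩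
  · rw [hgrad_comp x hx, norm_smul, Real.norm_eq_abs]
    exact mul_le_of_le_one_left (norm_nonneg _) (hf_le _)
  · rintro x ⟨hx | hx, hxU⟩
    · rw [hgrad_comp x hxU, hball₀ x (Metric.ball_subset_ball (min_le_left _ _) hx), one_smul]
    · rw [hgrad_comp x hxU, hball₁ x (Metric.ball_subset_ball (min_le_right _ _) hx), one_smul]
end
end
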